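/- Let F be an algebraically closed field of characteristic 0 and let f ∈ F[X] be a disintegrated polynomial of degree d ≥ 2. Let M(f^∞) denote the collection of all linear polynomials L ∈ F[X] that commute with some iterate of f. Then M(f^∞) is a finite cyclic group under composition. Moreover, if f̃ ∈ F[X] is a polynomial of lowest degree among polynomials of degree at least 2 commuting with some iterate of f, then there exists an integer D > 0 relatively prime to the order of M(f^∞) such that f̃∘L = L^D∘f̃ for every L ∈ M(f^∞), where L^D denotes the D-th compositional iterate of L. -/

import Mathlib

open Polynomial

/-- The `m`-th compositional iterate of a polynomial. -/
noncomputable def polIter {F : Type} [CommSemiring F] (f : Polynomial F) : ℕ → Polynomial F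
  | 0 => X
  | m + 1 => f.comp (polIter f m)

/-- Two polynomials commute under composition. -/
def PolyCommute {F : Type} [CommSemiring F] (f g : Polynomial F) : Prop :=
  f.comp g = g.comp f

/-- `g` commutes with some iterate `f^m` (`m ≥ 1`) of `f`. -/
def CommutesWithIterate {F : Type} [CommSemiring F] (f g : Polynomial F) : Prop :=
  ∃ m : ℕ, 1 ≤ m ∧ PolyCommute (polIter f m) g

/-- `c` is the Chebyshev polynomial of degree `d`, characterized by
`c(x + 1/x) = x^d + 1/x^d`. -/
def IsChebyshevPoly {F : Type} [Field F] (d : ℕ) (c : Polynomial F) : Prop :=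
  ∀ x : F, x ≠ 0 → c.eval (x + x⁻¹) = x ^ d + (x⁻¹) ^ d

/-- A polynomial over an algebraically closed field (or any field containing the relevant
conjugating data) is special if it is affinely conjugate to `X^d` or to `±C_d`. -/
def IsSpecialPolyAux {F : Type} [Field F] (f : Polynomial F) : Prop :=
  ∃ (a b : F), a ≠ 0 ∧
    ∃ g : Polynomial F,
      (g = X ^ f.natDegree ∨ IsChebyshevPoly f.natDegree g ∨
        IsChebyshevPoly f.natDegree (-g)) ∧
      (C a * X + C b).comp g = f.comp (C a * X + C b)

/-- A polynomial over `K` is special if it becomes special (conjugate to `X^d` or `±C_d`)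
over an algebraic closure of `K`. -/
def IsSpecialPoly {K : Type} [Field K] (f : Polynomial K) : Prop :=
  IsSpecialPolyAux (f.map (algebraMap K (AlgebraicClosure K)))

/-- A polynomial of degree at least 2 is disintegrated if it is not special. -/
def IsDisintegrated {K : Type} [Field K] (f : Polynomial K) : Prop :=
  2 ≤ f.natDegree ∧ ¬ IsSpecialPoly f

/-- A point of `P^1` is periodic under (the `P^1`-action of) a polynomial. -/
def P1Periodic {L : Type} [CommRing L] (f : Polynomial L) (ζ : OnePoint L) : Prop :=
  ∃ N : ℕ, 1 ≤ N ∧ (OnePoint.map fun a => f.eval a)^[N] ζ = ζ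

/-- A point of `P^1` is preperiodic under a polynomial. -/
def P1Preperiodic {L : Type} [CommRing L] (f : Polynomial L) (ζ : OnePoint L) : Prop :=
  ∃ k : ℕ, P1Periodic f ((OnePoint.map fun a => f.eval a)^[k] ζ)


/-- For an algebraically closed base field, `f` is disintegrated if it is not affinely
conjugate (over the field itself) to `X^d` or `±C_d`. -/
def IsDisintegratedAux {F : Type} [Field F] (f : Polynomial F) : Prop :=
  2 ≤ f.natDegree ∧ ¬ IsSpecialPolyAux f

/-- `M(f^∞)`: the collection of linear polynomials commuting with some iterate of `f`. -/
def linCommSet {F : Type} [Field F] (f : Polynomial F) : Set (Polynomial F) :=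
  {L : Polynomial F | L.natDegree = 1 ∧ CommutesWithIterate f L}

namespace LaurentOps

variable {F : Type} [Field F]

/-- Constants in Laurent series, through `HahnSeries.C`. -/
noncomputable instance laurentAlgebra : Algebra F (LaurentSeries F) :=
  HahnSeries.instAlgebra

instance laurentCharZero [CharZero F] : CharZero (LaurentSeries F) :=
  charZero_of_injective_algebraMap (FaithfulSMul.algebraMap_injective F (LaurentSeries F))

theorem coeff_algebraMap_zero (c : F) : (algebraMap F (LaurentSeries F) c).coeff 0 = c := by
  rw [HahnSeries.algebraMap_apply, HahnSeries.C_apply]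
  simp

theorem coeff_algebraMap_of_ne (c : F) {n : ℤ} (h : n ≠ 0) :
    (algebraMap F (LaurentSeries F) c).coeff n = 0 := by
  rw [HahnSeries.algebraMap_apply, HahnSeries.C_apply, HahnSeries.coeff_single_of_ne h]

/-- The substitution `t ↦ u t` on Laurent series in `s = 1/t`. -/
noncomputable def scale (u : Fˣ) : LaurentSeries F →ₐ[F] LaurentSeries F where
  toFun a := ⟨fun n => ((u ^ (-n) : Fˣ) : F) * a.coeff n,
    a.isPWO_support.mono fun n hn h => hn (by simp [h])⟩
  map_one' := by
    ext n
    by_cases h : n = 0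
    · subst h; simp
    · simp [HahnSeries.coeff_one, h]
  map_zero' := by ext n; simp
  map_add' a b := by ext n; simp [mul_add]
  map_mul' a b := by
    ext n
    simp only [HahnSeries.coeff_mul, Finset.mul_sum]
    refine Finset.sum_congr ?_ ?_
    · ext ⟨i, j⟩
      simp only [Finset.mem_antidiagonal, HahnSeries.mem_support]
      have (k : ℤ) (x : F) : ((u ^ (-k) : Fˣ) : F) * x ≠ 0 ↔ x ≠ 0 := by
        rw [Ne, Units.mul_right_eq_zero]
      exact and_congr (this _ _).symm (and_congr (this _ _).symm Iff.rfl)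
    · rintro ⟨i, j⟩ h
      simp only [Finset.mem_antidiagonal] at h
      obtain ⟨_, _, rfl⟩ := h
      rw [neg_add, zpow_add, Units.val_mul]
      ring
  commutes' c := by
    ext n
    by_cases h : n = 0
    · subst h; simp [coeff_algebraMap_zero]
    · simp only [coeff_algebraMap_of_ne c h, mul_zero]

@[simp] theorem coeff_scale (u : Fˣ) (a : LaurentSeries F) (n : ℤ) :
    (scale u a).coeff n = ((u ^ (-n) : Fˣ) : F) * a.coeff n := rfl

theorem scale_scale (u v : Fˣ) (a : LaurentSeries F) : scale u (scale v a) = scale (u * v) a := by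
  ext n
  simp [mul_zpow, mul_assoc, mul_comm]

theorem scale_one (a : LaurentSeries F) : scale 1 a = a := by
  ext n
  simp

theorem scale_injective (u : Fˣ) : Function.Injective (scale u : LaurentSeries F →ₐ[F] _) :=
  RingHom.injective (scale u).toRingHom

/-- The substitution `t ↦ t ^ N`. -/
noncomputable def expand (N : ℕ) (hN : 0 < N) : LaurentSeries F →ₐ[F] LaurentSeries F :=
  HahnSeries.embDomainAlgHom (AddMonoidHom.mulLeft (N : ℤ))
    (fun a b h => by
      have : (N : ℤ) ≠ 0 := by positivity
      exact mul_left_cancel₀ this h)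
    (fun a b => by
      have : (0 : ℤ) < N := by positivity
      exact mul_le_mul_iff_right₀ this)

@[simp] theorem coeff_expand_mul (N : ℕ) (hN : 0 < N) (a : LaurentSeries F) (n : ℤ) :
    (expand N hN a).coeff (N * n) = a.coeff n :=
  HahnSeries.embDomain_coeff

theorem coeff_expand_of_not_dvd (N : ℕ) (hN : 0 < N) (a : LaurentSeries F) (n : ℤ)
    (h : ¬ (N : ℤ) ∣ n) : (expand N hN a).coeff n = 0 := by
  refine HahnSeries.embDomain_of_notMem_range (x := a) ?_
  rintro ⟨m, hm⟩
  exact h ⟨m, hm.symm⟩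

theorem expand_injective (N : ℕ) (hN : 0 < N) :
    Function.Injective (expand N hN : LaurentSeries F →ₐ[F] _) :=
  RingHom.injective (expand N hN : LaurentSeries F →ₐ[F] LaurentSeries F).toRingHom

theorem expand_expand (M N : ℕ) (hM : 0 < M) (hN : 0 < N) (a : LaurentSeries F) :
    expand M hM (expand N hN a) = expand (M * N) (Nat.mul_pos hM hN) a := by
  have hM' : (M : ℤ) ≠ 0 := by positivity
  ext n
  by_cases h : (M : ℤ) ∣ n
  · obtain ⟨n, rfl⟩ := h
    rw [coeff_expand_mul]
    by_cases h : (N : ℤ) ∣ n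
    · obtain ⟨n, rfl⟩ := h
      rw [coeff_expand_mul, ← mul_assoc, ← Nat.cast_mul, coeff_expand_mul]
    · rw [coeff_expand_of_not_dvd _ _ _ _ h, coeff_expand_of_not_dvd]
      rw [Nat.cast_mul]
      exact fun h' => h (Int.dvd_of_mul_dvd_mul_left hM' h')
  · rw [coeff_expand_of_not_dvd _ _ _ _ h, coeff_expand_of_not_dvd]
    rw [Nat.cast_mul]
    exact fun h' => h (dvd_of_mul_right_dvd h')

theorem scale_expand (u : Fˣ) (N : ℕ) (hN : 0 < N) (a : LaurentSeries F) :
    scale u (expand N hN a) = expand N hN (scale (u ^ N) a) := by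
  ext n
  by_cases h : (N : ℤ) ∣ n
  · obtain ⟨n, rfl⟩ := h
    simp only [coeff_scale, coeff_expand_mul]
    rw [← zpow_natCast, ← zpow_mul]
    simp
  · rw [coeff_expand_of_not_dvd _ _ _ _ h, coeff_scale, coeff_expand_of_not_dvd _ _ _ _ h, mul_zero]

/-- The projection onto exponents divisible by `N`, followed by `t ^ N ↦ t`. -/
noncomputable def contract (N : ℕ) (hN : 0 < N) : LaurentSeries F →ₗ[F] LaurentSeries F where
  toFun a := HahnSeries.ofSuppBddBelow (fun n => a.coeff (N * n)) (by
    refine ⟨-|a.order|, fun m hm => ?_⟩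
    by_contra hlt
    rw [not_le] at hlt
    refine hm ?_
    apply HahnSeries.coeff_eq_zero_of_lt_order
    have h1 : (1 : ℤ) ≤ N := by exact_mod_cast hN
    have h2 : m < 0 := lt_of_lt_of_le hlt (by simp)
    have h3 := neg_abs_le a.order
    nlinarith)
  map_add' a b := by ext n; rfl
  map_smul' c a := by ext n; rfl

@[simp] theorem coeff_contract (N : ℕ) (hN : 0 < N) (a : LaurentSeries F) (n : ℤ) :
    (contract N hN a).coeff n = a.coeff (N * n) := rfl

theorem contract_expand (N : ℕ) (hN : 0 < N) (a : LaurentSeries F) :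
    contract N hN (expand N hN a) = a := by
  ext n
  simp

theorem nsmul_expand_contract (N : ℕ) (hN : 0 < N) (μ : Fˣ) (hμ : IsPrimitiveRoot μ N)
    (a : LaurentSeries F) :
    (N : LaurentSeries F) * expand N hN (contract N hN a) =
      ∑ j ∈ Finset.range N, scale (μ ^ j) a := by
  have key : ∀ n : ℤ, (∑ j ∈ Finset.range N, scale (μ ^ j) a).coeff n =
      (∑ j ∈ Finset.range N, (((μ ^ (-n) : Fˣ) : F)) ^ j) * a.coeff n := by
    intro n
    rw [HahnSeries.coeff_sum, Finset.sum_mul]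
    refine Finset.sum_congr rfl fun j _ => ?_
    rw [coeff_scale, ← Units.val_pow_eq_pow_val, ← zpow_natCast, ← zpow_natCast, ← zpow_mul,
      ← zpow_mul, mul_comm (j : ℤ)]
  ext n
  rw [key, ← nsmul_eq_mul, HahnSeries.coeff_nsmul, Pi.smul_apply, nsmul_eq_mul]
  by_cases h : (N : ℤ) ∣ n
  · have h1 : μ ^ (-n) = 1 := by
      rw [hμ.zpow_eq_one_iff_dvd]
      exact (dvd_neg).2 h
    rw [h1]
    obtain ⟨n, rfl⟩ := h
    simp
  · have h1 : μ ^ (-n) ≠ 1 := by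
      rw [Ne, hμ.zpow_eq_one_iff_dvd, dvd_neg]
      exact h
    have h2 : (((μ ^ (-n) : Fˣ) : F)) ≠ 1 := by simpa [Units.ext_iff] using h1
    have h3 : (((μ ^ (-n) : Fˣ) : F)) ^ N = 1 := by
      rw [← Units.val_pow_eq_pow_val, ← zpow_natCast, ← zpow_mul, mul_comm, zpow_mul, zpow_natCast,
        hμ.pow_eq_one, one_zpow, Units.val_one]
    rw [geom_sum_eq h2, h3, coeff_expand_of_not_dvd _ _ _ _ h]
    simp

theorem exists_units_isPrimitiveRoot [IsAlgClosed F] [CharZero F] (N : ℕ) (hN : 0 < N) :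
    ∃ μ : Fˣ, IsPrimitiveRoot μ N := by
  have : NeZero (N : F) := ⟨by exact_mod_cast hN.ne'⟩
  obtain ⟨μ, hμ⟩ := HasEnoughRootsOfUnity.exists_primitiveRoot F N
  exact ⟨(hμ.isUnit hN.ne').unit, IsPrimitiveRoot.coe_units_iff.1 (by simpa using hμ)⟩

theorem contract_expand_mul [IsAlgClosed F] [CharZero F] (N : ℕ) (hN : 0 < N)
    (a b : LaurentSeries F) :
    contract N hN (expand N hN a * b) = a * contract N hN b := by
  obtain ⟨μ, hμ⟩ := exists_units_isPrimitiveRoot (F := F) N hN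
  apply expand_injective N hN
  have hN0 : (N : LaurentSeries F) ≠ 0 := Nat.cast_ne_zero.2 hN.ne'
  apply mul_left_cancel₀ hN0
  rw [nsmul_expand_contract N hN μ hμ, map_mul, mul_left_comm, nsmul_expand_contract N hN μ hμ,
    Finset.mul_sum]
  refine Finset.sum_congr rfl fun j _ => ?_
  rw [map_mul, scale_expand, ← pow_mul, mul_comm j, pow_mul, hμ.pow_eq_one, one_pow, scale_one]

/-- `a` has degree at most `n` in `t`, and the coefficient of `t ^ n` is `c`. -/
def IsTop (a : LaurentSeries F) (n : ℤ) (c : F) : Prop :=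
  (∀ i, n < i → a.coeff (-i) = 0) ∧ a.coeff (-n) = c

namespace IsTop

variable {a b : LaurentSeries F} {n m : ℤ} {c c' : F}

theorem add (ha : IsTop a n c) (hb : IsTop b n c') : IsTop (a + b) n (c + c') :=
  ⟨fun i hi => by simp [ha.1 i hi, hb.1 i hi], by simp [ha.2, hb.2]⟩

theorem sub (ha : IsTop a n c) (hb : IsTop b n c') : IsTop (a - b) n (c - c') :=
  ⟨fun i hi => by simp [ha.1 i hi, hb.1 i hi], by simp [ha.2, hb.2]⟩

theorem mul (ha : IsTop a n c) (hb : IsTop b m c') : IsTop (a * b) (n + m) (c * c') := by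
  have hle : ∀ k, a.coeff k ≠ 0 → -n ≤ k := fun k hk => by
    by_contra h
    exact hk (by simpa using ha.1 (-k) (by omega))
  have hle' : ∀ k, b.coeff k ≠ 0 → -m ≤ k := fun k hk => by
    by_contra h
    exact hk (by simpa using hb.1 (-k) (by omega))
  constructor
  · intro i hi
    rw [HahnSeries.coeff_mul]
    refine Finset.sum_eq_zero ?_
    rintro ⟨p, q⟩ h
    simp only [Finset.mem_antidiagonal, HahnSeries.mem_support] at h
    have := hle p h.1
    have := hle' q h.2.1
    omega
  · rw [HahnSeries.coeff_mul, ← ha.2, ← hb.2]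
    refine Finset.sum_eq_single (-n, -m) ?_ ?_
    · rintro ⟨p, q⟩ h hne
      simp only [Finset.mem_antidiagonal, HahnSeries.mem_support] at h
      have := hle p h.1
      have := hle' q h.2.1
      exact absurd (Prod.ext (by simp; omega) (by simp; omega)) hne
    · intro h
      simp only [Finset.mem_antidiagonal, HahnSeries.mem_support, not_and] at h
      by_contra h'
      exact h (left_ne_zero_of_mul h') (right_ne_zero_of_mul h') (by ring)

theorem lower (ha : IsTop a n c) (h : n < m) : IsTop a m 0 :=
  ⟨fun i hi => ha.1 i (h.trans hi), ha.1 m h⟩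

theorem algebraMap (c : F) : IsTop (algebraMap F (LaurentSeries F) c) 0 c :=
  ⟨fun i hi => coeff_algebraMap_of_ne c (by omega), coeff_algebraMap_zero c⟩

theorem one : IsTop (1 : LaurentSeries F) 0 1 := by
  simpa using algebraMap (1 : F)

theorem zero (n : ℤ) : IsTop (0 : LaurentSeries F) n 0 := ⟨fun _ _ => rfl, rfl⟩

theorem pow (ha : IsTop a n c) (k : ℕ) : IsTop (a ^ k) (k * n) (c ^ k) := by
  induction k with
  | zero => simpa using one
  | succ k ih =>
    rw [pow_succ, pow_succ]
    convert ih.mul ha using 1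
    push_cast
    ring

theorem sum {ι : Type*} (s : Finset ι) {a : ι → LaurentSeries F} {c : ι → F}
    (h : ∀ i ∈ s, IsTop (a i) n (c i)) : IsTop (∑ i ∈ s, a i) n (∑ i ∈ s, c i) := by
  constructor
  · intro i hi
    rw [HahnSeries.coeff_sum]
    exact Finset.sum_eq_zero fun j hj => (h j hj).1 i hi
  · rw [HahnSeries.coeff_sum]
    exact Finset.sum_congr rfl fun j hj => (h j hj).2

theorem const_mul (c : F) (hb : IsTop b m c') :
    IsTop (Algebra.algebraMap F (LaurentSeries F) c * b) m (c * c') := by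
  simpa using (algebraMap c).mul hb

theorem scale (ha : IsTop a n c) (u : Fˣ) : IsTop (scale u a) n (((u ^ n : Fˣ) : F) * c) :=
  ⟨fun i hi => by simp [ha.1 i hi], by simp [ha.2]⟩

theorem expand (ha : IsTop a n c) (N : ℕ) (hN : 0 < N) : IsTop (expand N hN a) (N * n) c := by
  constructor
  · intro i hi
    by_cases h : (N : ℤ) ∣ i
    · obtain ⟨i, rfl⟩ := h
      rw [← mul_neg, coeff_expand_mul]
      exact ha.1 i (lt_of_mul_lt_mul_left hi (by positivity))
    · exact coeff_expand_of_not_dvd _ _ _ _ (by rwa [dvd_neg])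
  · rw [← mul_neg, coeff_expand_mul, ha.2]

theorem contract_of_lt (ha : IsTop a n c) (N : ℕ) (hN : 0 < N) (h : n < N) :
    IsTop (contract N hN a) 0 (a.coeff 0) := by
  constructor
  · intro i hi
    rw [coeff_contract, mul_neg]
    refine ha.1 _ (lt_of_lt_of_le h ?_)
    have : (0 : ℤ) < N := by exact_mod_cast hN
    nlinarith
  · simp

theorem aeval (ha : IsTop a n c) (hn : 0 < n) (p : F[X]) :
    IsTop (aeval a p) (p.natDegree * n) (p.leadingCoeff * c ^ p.natDegree) := by
  rw [aeval_eq_sum_range, Finset.sum_range_succ]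
  have h1 : IsTop (∑ i ∈ Finset.range p.natDegree, p.coeff i • a ^ i) (p.natDegree * n) 0 := by
    have := IsTop.sum (n := p.natDegree * n) (Finset.range p.natDegree)
      (a := fun i => p.coeff i • a ^ i) (c := fun _ => 0) (fun i hi => by
        rw [Algebra.smul_def]
        refine ((ha.pow i).const_mul _).lower ?_
        have := Finset.mem_range.1 hi
        have : (i : ℤ) < p.natDegree := by exact_mod_cast this
        exact mul_lt_mul_of_pos_right this hn)
    simpa using this
  have h2 := (ha.pow p.natDegree).const_mul p.leadingCoeff
  rw [Algebra.smul_def]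
  simpa using h1.add h2

theorem eq_of (h : IsTop a n c) (h' : IsTop a n c') : c = c' := h.2.symm.trans h'.2

end IsTop

theorem aeval_injective_of_isTop {a : LaurentSeries F} {n : ℤ} {c : F} (ha : IsTop a n c)
    (hn : 0 < n) (hc : c ≠ 0) : Function.Injective (aeval a : F[X] →ₐ[F] LaurentSeries F) := by
  rw [injective_iff_map_eq_zero]
  intro p hp
  by_contra h
  have h1 := (ha.aeval hn p).2
  rw [hp, HahnSeries.coeff_zero] at h1
  exact mul_ne_zero (leadingCoeff_ne_zero.2 h) (pow_ne_zero _ hc) h1.symm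

theorem expand_congr {M N : ℕ} (h : M = N) (hM : 0 < M) (hN : 0 < N) (a : LaurentSeries F) :
    expand M hM a = expand N hN a := by
  subst h
  rfl

theorem exists_isTop {a : LaurentSeries F} (ha : a ≠ 0) : ∃ n c, c ≠ 0 ∧ IsTop a n c :=
  ⟨-a.order, a.coeff a.order, HahnSeries.coeff_order_eq_zero.not.2 ha,
    fun _ hi => HahnSeries.coeff_eq_zero_of_lt_order (by omega), by rw [neg_neg]⟩

theorem IsTop.degree_unique {a : LaurentSeries F} {n m : ℤ} {c c' : F} (h : IsTop a n c)
    (h' : IsTop a m c') (hc : c ≠ 0) (hc' : c' ≠ 0) : n = m := by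
  rcases lt_trichotomy n m with hlt | rfl | hlt
  · exact absurd ((h.lower hlt).eq_of h').symm hc'
  · rfl
  · exact absurd ((h'.lower hlt).eq_of h).symm hc

theorem exists_fixedPoint (T : PowerSeries F → PowerSeries F) (b : F)
    (hb : ∀ g, PowerSeries.constantCoeff g = b → PowerSeries.constantCoeff (T g) = b)
    (hT : ∀ n g g', 1 ≤ n → PowerSeries.constantCoeff g = b → PowerSeries.constantCoeff g' = b →
      PowerSeries.X ^ n ∣ g - g' → PowerSeries.X ^ (n + 1) ∣ T g - T g') :
    ∃ g, PowerSeries.constantCoeff g = b ∧ T g = g := by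
  set u : ℕ → PowerSeries F := fun j => T^[j] (PowerSeries.C b) with hu
  have hu1 (j : ℕ) : u (j + 1) = T (u j) := Function.iterate_succ_apply' _ _ _
  have hc (j : ℕ) : PowerSeries.constantCoeff (u j) = b := by
    induction j with
    | zero => simp [hu]
    | succ j ih => rw [hu1]; exact hb _ ih
  have hstep (j : ℕ) : PowerSeries.X ^ (j + 1) ∣ u (j + 1) - u j := by
    induction j with
    | zero => rw [zero_add, pow_one, PowerSeries.X_dvd_iff, map_sub, hc, hc, sub_self]
    | succ j ih =>
      rw [hu1, hu1 j]
      exact hT _ _ _ (by omega) (by rw [← hu1]; exact hc _) (hc _) (by rw [← hu1]; exact ih)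
  have hstep' (j k : ℕ) : PowerSeries.X ^ (j + 1) ∣ u (j + k) - u j := by
    induction k with
    | zero => simp
    | succ k ih =>
      rw [← sub_add_sub_cancel _ (u (j + k))]
      exact dvd_add ((pow_dvd_pow _ (by omega)).trans (hstep (j + k))) ih
  set g : PowerSeries F := PowerSeries.mk fun i => PowerSeries.coeff i (u i) with hg
  have hgu (j : ℕ) : PowerSeries.X ^ (j + 1) ∣ g - u j := by
    rw [PowerSeries.X_pow_dvd_iff]
    intro m hm
    obtain ⟨k, rfl⟩ := Nat.exists_eq_add_of_le (Nat.lt_succ_iff.1 hm)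
    have := PowerSeries.X_pow_dvd_iff.1 (hstep' m k) m (by omega)
    rw [map_sub] at this ⊢
    rw [hg, PowerSeries.coeff_mk, ← neg_sub, this, neg_zero]
  have hgc : PowerSeries.constantCoeff g = b := by
    have := hgu 0
    rw [zero_add, pow_one, PowerSeries.X_dvd_iff, map_sub, hc, sub_eq_zero] at this
    exact this
  refine ⟨g, hgc, ?_⟩
  rw [← sub_eq_zero]
  ext i
  have h1 := hT _ _ _ (by omega) hgc (hc i) (hgu i)
  have h2 := hgu (i + 1)
  rw [hu1] at h2
  have h3 := dvd_sub h1 h2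
  rw [sub_sub_sub_cancel_right] at h3
  simpa using PowerSeries.X_pow_dvd_iff.1 h3 i (by omega)

theorem expand_coe (d : ℕ) (hd : 0 < d) (g : PowerSeries F) :
    expand d hd (HahnSeries.ofPowerSeries ℤ F g) =
      HahnSeries.ofPowerSeries ℤ F (PowerSeries.expand d hd.ne' g) := by
  ext n
  by_cases h : (d : ℤ) ∣ n
  · obtain ⟨n, rfl⟩ := h
    rw [coeff_expand_mul]
    rcases lt_or_ge n 0 with hn | hn
    · rw [PowerSeries.coeff_coe, PowerSeries.coeff_coe, if_pos hn, if_pos]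
      have : (0 : ℤ) < d := by exact_mod_cast hd
      exact mul_neg_of_pos_of_neg this hn
    · lift n to ℕ using hn
      rw [← Nat.cast_mul, LaurentSeries.coeff_coe_powerSeries, LaurentSeries.coeff_coe_powerSeries,
        PowerSeries.coeff_expand_mul]
  · rw [coeff_expand_of_not_dvd _ _ _ _ h, PowerSeries.coeff_coe]
    split_ifs with hn
    · rfl
    · rw [PowerSeries.coeff_expand_of_not_dvd]
      rwa [← Int.natCast_dvd]

/-- The Böttcher coordinate at infinity of a polynomial of degree at least two. -/
theorem exists_boettcher [CharZero F] (f : F[X]) (d : ℕ) (hfd : f.natDegree = d) (hd : 2 ≤ d)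
    (b : F) (hfb : f.leadingCoeff * b ^ (d - 1) = 1) :
    ∃ ψ : LaurentSeries F, IsTop ψ 1 b ∧ aeval ψ f = expand d (by omega) ψ := by
  have hd0 : (d : F) ≠ 0 := by exact_mod_cast (by omega : d ≠ 0)
  have hdne : d ≠ 0 := by omega
  set Φ : PowerSeries F → PowerSeries F := fun g =>
    ∑ k ∈ Finset.range (d + 1), PowerSeries.C (f.coeff k) * PowerSeries.X ^ (d - k) * g ^ k with hΦ
  have hΦ' (g : PowerSeries F) : Φ g = PowerSeries.C f.leadingCoeff * g ^ d +
      PowerSeries.X * ∑ k ∈ Finset.range d,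
        PowerSeries.C (f.coeff k) * PowerSeries.X ^ (d - 1 - k) * g ^ k := by
    simp only [hΦ]
    rw [Finset.sum_range_succ, add_comm, Finset.mul_sum, ← hfd, coeff_natDegree, Nat.sub_self,
      pow_zero, mul_one]
    congr 1
    refine Finset.sum_congr rfl fun k hk => ?_
    have := Finset.mem_range.1 hk
    rw [show f.natDegree - k = f.natDegree - 1 - k + 1 by omega, pow_succ]
    ring
  obtain ⟨g, hgb, hg⟩ := exists_fixedPoint
    (fun g => g - PowerSeries.C ((d : F)⁻¹) * (Φ g - PowerSeries.expand d hdne g)) b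
    (by
      intro g hg
      have h1 : PowerSeries.constantCoeff (Φ g) = b := by
        rw [hΦ']
        simp only [map_add, map_mul, map_pow, PowerSeries.constantCoeff_C, hg,
          PowerSeries.constantCoeff_X, zero_mul, add_zero]
        rw [← mul_pow_sub_one hdne, mul_left_comm, hfb, mul_one]
      rw [map_sub, map_mul, map_sub, h1, PowerSeries.constantCoeff_expand, hg]
      simp)
    (by
      intro n g g' hn hg hg' hdvd
      obtain ⟨δ, hδ⟩ := hdvd
      have h1 : PowerSeries.X ^ (n + 1) ∣
          PowerSeries.expand d hdne g - PowerSeries.expand d hdne g' := by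
        rw [← map_sub, hδ, map_mul, map_pow, PowerSeries.expand_X, ← pow_mul]
        exact ((pow_dvd_pow _ (by nlinarith)).trans (dvd_mul_right _ _))
      have h2 (k : ℕ) : PowerSeries.X ^ n ∣ g ^ k - g' ^ k :=
        (Dvd.intro _ hδ.symm).trans (sub_dvd_pow_sub_pow _ _ _)
      have h3 : PowerSeries.X ^ (n + 1) ∣ (g - g') -
          PowerSeries.C ((d : F)⁻¹) * (PowerSeries.C f.leadingCoeff * (g ^ d - g' ^ d)) := by
        rw [← geom_sum₂_mul, hδ, pow_succ]
        have : PowerSeries.X ∣ 1 - PowerSeries.C ((d : F)⁻¹) * (PowerSeries.C f.leadingCoeff *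
            ∑ i ∈ Finset.range d, g ^ i * g' ^ (d - 1 - i)) := by
          rw [PowerSeries.X_dvd_iff]
          simp only [map_sub, map_one, map_mul, PowerSeries.constantCoeff_C, map_sum, map_pow, hg,
            hg']
          rw [Finset.sum_congr rfl (g := fun _ => b ^ (d - 1))]
          · rw [Finset.sum_const, Finset.card_range, nsmul_eq_mul]
            rw [mul_left_comm, inv_mul_cancel_left₀ hd0, hfb, sub_self]
          · intro i hi
            have := Finset.mem_range.1 hi
            rw [← pow_add, show i + (d - 1 - i) = d - 1 by omega]
        obtain ⟨e, he⟩ := this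
        refine ⟨δ * e, ?_⟩
        linear_combination (PowerSeries.X ^ n * δ) * he
      have h4 : PowerSeries.X ^ (n + 1) ∣ (PowerSeries.X * ∑ k ∈ Finset.range d,
          PowerSeries.C (f.coeff k) * PowerSeries.X ^ (d - 1 - k) * g ^ k) -
          PowerSeries.X * ∑ k ∈ Finset.range d,
          PowerSeries.C (f.coeff k) * PowerSeries.X ^ (d - 1 - k) * g' ^ k := by
        rw [← mul_sub, ← Finset.sum_sub_distrib, pow_succ']
        refine mul_dvd_mul_left _ (Finset.dvd_sum fun k _ => ?_)
        rw [← mul_sub]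
        exact (h2 k).mul_left _
      rw [hΦ', hΦ']
      convert dvd_sub (dvd_add h3 (h1.mul_left (PowerSeries.C ((d : F)⁻¹))))
          (h4.mul_left (PowerSeries.C ((d : F)⁻¹))) using 1
      ring)
  have hgΦ : Φ g = PowerSeries.expand d hdne g := by
    have h1 : PowerSeries.C ((d : F)⁻¹) * (Φ g - PowerSeries.expand d hdne g) = 0 := by
      simpa using hg
    rw [mul_eq_zero, sub_eq_zero] at h1
    refine h1.resolve_left fun h => inv_ne_zero hd0 ?_
    simpa using congrArg PowerSeries.constantCoeff h
  set t : LaurentSeries F := HahnSeries.single (-1) 1 with ht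
  have htop : IsTop t 1 1 :=
    ⟨fun i hi => HahnSeries.coeff_single_of_ne (by omega), by simp [ht]⟩
  have htX : t * HahnSeries.ofPowerSeries ℤ F PowerSeries.X = 1 := by
    rw [HahnSeries.ofPowerSeries_X, ht, HahnSeries.single_mul_single]
    simp
  have htexp : expand d (by omega) t = t ^ d := by
    ext n
    rw [ht, HahnSeries.single_pow, one_pow]
    by_cases h : (d : ℤ) ∣ n
    · obtain ⟨n, rfl⟩ := h
      rw [coeff_expand_mul]
      have hd' : (d : ℤ) ≠ 0 := by exact_mod_cast hdne
      by_cases hn : n = -1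
      · subst hn; simp
      · rw [HahnSeries.coeff_single_of_ne hn, HahnSeries.coeff_single_of_ne]
        rw [nsmul_eq_mul]
        exact fun h => hn (mul_left_cancel₀ hd' h)
    · rw [coeff_expand_of_not_dvd _ _ _ _ h, HahnSeries.coeff_single_of_ne]
      rintro rfl
      exact h (by simp)
  refine ⟨t * HahnSeries.ofPowerSeries ℤ F g, ?_, ?_⟩
  · have : IsTop (HahnSeries.ofPowerSeries ℤ F g) 0 b := by
      refine ⟨fun i hi => ?_, ?_⟩
      · rw [PowerSeries.coeff_coe, if_pos (by omega)]
      · rw [neg_zero, ← Nat.cast_zero, LaurentSeries.coeff_coe_powerSeries, ← hgb]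
        simp
    simpa using htop.mul this
  · rw [map_mul, htexp, expand_coe, ← hgΦ, aeval_eq_sum_range, hfd, hΦ, map_sum, Finset.mul_sum]
    refine Finset.sum_congr rfl fun k hk => ?_
    have hk' : k ≤ d := Nat.lt_succ_iff.1 (Finset.mem_range.1 hk)
    rw [Algebra.smul_def, map_mul, map_mul, map_pow, map_pow, HahnSeries.ofPowerSeries_C]
    change HahnSeries.C _ * _ = _
    rw [mul_pow]
    have : t ^ d * HahnSeries.ofPowerSeries ℤ F PowerSeries.X ^ (d - k) = t ^ k := by
      rw [← Nat.add_sub_of_le hk', pow_add, mul_assoc, Nat.add_sub_cancel_left, ← mul_pow, htX,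
        one_pow, mul_one]
    rw [← this]
    ring

theorem aeval_sub_aeval (p : F[X]) {a a' : LaurentSeries F} {n : ℤ} {c : F} (hn : 0 < n)
    (ha : IsTop a n c) (ha' : IsTop a' n c) (hp : 0 < p.natDegree) :
    ∃ G, IsTop G ((p.natDegree - 1 : ℤ) * n)
        (p.leadingCoeff * (p.natDegree * c ^ (p.natDegree - 1))) ∧
      aeval a p - aeval a' p = G * (a - a') := by
  have hk (k : ℕ) (hk : 0 < k) : IsTop (∑ i ∈ Finset.range k, a ^ i * a' ^ (k - 1 - i))
      ((k - 1 : ℤ) * n) (k * c ^ (k - 1)) := by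
    have := IsTop.sum (n := (k - 1 : ℤ) * n) (Finset.range k)
      (a := fun i => a ^ i * a' ^ (k - 1 - i)) (c := fun _ => c ^ (k - 1)) fun i hi => by
        have := Finset.mem_range.1 hi
        convert (ha.pow i).mul (ha'.pow (k - 1 - i)) using 1
        · rw [← add_mul]
          congr 1
          omega
        · rw [← pow_add]
          congr 1
          omega
    simpa using this
  refine ⟨∑ k ∈ Finset.range (p.natDegree + 1), algebraMap F (LaurentSeries F) (p.coeff k) *
      ∑ i ∈ Finset.range k, a ^ i * a' ^ (k - 1 - i), ?_, ?_⟩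
  · rw [Finset.sum_range_succ]
    have h1 := IsTop.sum (n := (p.natDegree - 1 : ℤ) * n) (Finset.range p.natDegree)
      (a := fun k => algebraMap F (LaurentSeries F) (p.coeff k) *
        ∑ i ∈ Finset.range k, a ^ i * a' ^ (k - 1 - i)) (c := fun _ => 0) fun k hk' => by
        have hlt := Finset.mem_range.1 hk'
        rcases Nat.eq_zero_or_pos k with rfl | hpos
        · simpa using IsTop.zero _
        · refine ((hk k hpos).const_mul _).lower (mul_lt_mul_of_pos_right ?_ hn)
          omega
    simpa using h1.add ((hk _ hp).const_mul p.leadingCoeff)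
  · rw [aeval_eq_sum_range, aeval_eq_sum_range, ← Finset.sum_sub_distrib, Finset.sum_mul]
    refine Finset.sum_congr rfl fun k _ => ?_
    rw [mul_assoc, geom_sum₂_mul, Algebra.smul_def, Algebra.smul_def, mul_sub]

theorem eq_of_aeval_eq_expand [CharZero F] (p : F[X]) (hp : 2 ≤ p.natDegree)
    {a a' : LaurentSeries F} {n : ℤ} {c : F} (hn : 0 < n) (hc : c ≠ 0)
    (ha : IsTop a n c) (ha' : IsTop a' n c)
    (h : aeval a p = expand p.natDegree (by omega) a)
    (h' : aeval a' p = expand p.natDegree (by omega) a') : a = a' := by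
  by_contra hne
  obtain ⟨k, γ, hγ, htop⟩ := exists_isTop (sub_ne_zero.2 hne)
  obtain ⟨G, hG, hsub⟩ := aeval_sub_aeval p hn ha ha' (by omega)
  rw [h, h', ← map_sub] at hsub
  have h1 := hG.mul htop
  rw [← hsub] at h1
  have h2 := htop.expand p.natDegree (by omega)
  have hp0 : p ≠ 0 := by
    rintro rfl
    simp at hp
  have hN : (p.natDegree : F) ≠ 0 := by exact_mod_cast (by omega : p.natDegree ≠ 0)
  have h3 := h2.degree_unique h1 hγ
    (mul_ne_zero (mul_ne_zero (leadingCoeff_ne_zero.2 hp0) (mul_ne_zero hN (pow_ne_zero _ hc))) hγ)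
  have h4 : ((p.natDegree : ℤ) - 1) * (k - n) = 0 := by linear_combination h3
  have h5 : k = n := by
    rcases mul_eq_zero.1 h4 with h | h
    · omega
    · omega
  subst h5
  exact hγ (by simpa using htop.eq_of (ha.sub ha'))

theorem natDegree_polIter (f : F[X]) (m : ℕ) : (polIter f m).natDegree = f.natDegree ^ m := by
  induction m with
  | zero => simp [polIter]
  | succ m ih => rw [polIter, natDegree_comp, ih, pow_succ']

theorem aeval_polIter {f : F[X]} {d : ℕ} (hd : 0 < d) {ψ : LaurentSeries F}
    (h : aeval ψ f = expand d hd ψ) (m : ℕ) :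
    aeval ψ (polIter f m) = expand (d ^ m) (Nat.pow_pos hd) ψ := by
  induction m with
  | zero =>
    rw [polIter, aeval_X]
    ext n
    have := coeff_expand_mul (d ^ 0) (Nat.pow_pos hd) ψ n
    simpa using this.symm
  | succ m ih =>
    rw [polIter, aeval_comp, ih, aeval_algHom_apply, h, expand_expand]
    exact expand_congr (pow_succ _ _).symm _ _ _

/-- A polynomial commuting with an iterate of `f` acts on the Böttcher coordinate as
`t ↦ c t ^ e`. -/
theorem aeval_of_commutesWithIterate [CharZero F] {f : F[X]} {d : ℕ} (hfd : f.natDegree = d)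
    (hd : 2 ≤ d) {ψ : LaurentSeries F} {b : F} (hb : b ≠ 0) (hψ : IsTop ψ 1 b)
    (hfψ : aeval ψ f = expand d (by omega) ψ) {g : F[X]} {m : ℕ} (hm : 1 ≤ m)
    (hg : PolyCommute (polIter f m) g) (hg1 : 0 < g.natDegree) :
    ∃ c : Fˣ, c ^ (d ^ m) = c ∧ aeval ψ g = expand g.natDegree hg1 (scale c ψ) ∧
      (c : F) * b = g.leadingCoeff * b ^ g.natDegree := by
  set p := polIter f m with hp
  have hN : p.natDegree = d ^ m := by rw [hp, natDegree_polIter, hfd]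
  have hN2 : 2 ≤ p.natDegree := hN ▸ hd.trans (Nat.le_self_pow (by omega) d)
  have hpψ : aeval ψ p = expand p.natDegree (by omega) ψ :=
    (aeval_polIter (by omega) hfψ m).trans (expand_congr hN.symm _ _ _)
  have hg0 : g.leadingCoeff ≠ 0 := by
    rw [leadingCoeff_ne_zero]
    rintro rfl
    simp at hg1
  have hχ := hψ.aeval one_pos g
  rw [mul_one] at hχ
  have hpχ : aeval (aeval ψ g) p = expand p.natDegree (by omega) (aeval ψ g) := by
    rw [← aeval_comp, hg, aeval_comp, hpψ, aeval_algHom_apply]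
  have hgpos : (0 : ℤ) < g.natDegree := by exact_mod_cast hg1
  have e1 := (hχ.aeval hgpos p).eq_of (hpχ ▸ hχ.expand p.natDegree (by omega))
  have e2 := (hψ.aeval one_pos p).eq_of (hpψ ▸ (hψ.expand p.natDegree (by omega)))
  set c : Fˣ := Units.mk0 (g.leadingCoeff * b ^ g.natDegree * b⁻¹)
    (mul_ne_zero (mul_ne_zero hg0 (pow_ne_zero _ hb)) (inv_ne_zero hb)) with hc
  have hcb : (c : F) * b = g.leadingCoeff * b ^ g.natDegree := by
    rw [hc, Units.val_mk0, inv_mul_cancel_right₀ hb]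
  have hcN : c ^ p.natDegree = c := by
    ext
    rw [Units.val_pow_eq_pow_val]
    apply mul_right_cancel₀ hb
    rw [← hcb, mul_pow] at e1
    nth_rewrite 1 [← e2]
    linear_combination e1
  refine ⟨c, hN ▸ hcN, ?_, hcb⟩
  have hχ' := (hψ.scale c).expand g.natDegree hg1
  rw [mul_one, zpow_one, hcb] at hχ'
  refine eq_of_aeval_eq_expand p hN2 hgpos (mul_ne_zero hg0 (pow_ne_zero _ hb)) hχ hχ' hpχ ?_
  rw [aeval_algHom_apply, aeval_algHom_apply, hpψ, scale_expand, hcN, expand_expand, expand_expand]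
  exact expand_congr (mul_comm _ _) _ _ _

end LaurentOps

namespace PowerSums

variable {F L ι : Type*} [Field F] [Field L] [Algebra F L] [Fintype ι]

theorem aeval_psum (x : ι → L) (k : ℕ) :
    MvPolynomial.aeval x (MvPolynomial.psum ι L k) = ∑ i, x i ^ k := by
  simp [MvPolynomial.psum]

theorem sum_pow_mem_of_esymm_mem (S : Subring L) (x : ι → L)
    (h : ∀ k, MvPolynomial.aeval x (MvPolynomial.esymm ι L k) ∈ S) (k : ℕ) :
    ∑ i, x i ^ k ∈ S := by
  classical
  induction k using Nat.strong_induction_on with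
  | _ k ih =>
    rcases Nat.eq_zero_or_pos k with rfl | hk
    · simp
    · rw [← aeval_psum, MvPolynomial.psum_eq_mul_esymm_sub_sum ι L k hk, map_sub, map_mul, map_sum]
      refine S.sub_mem ?_ (S.sum_mem fun a ha => ?_)
      · rw [map_mul, map_pow, map_neg, map_one, map_natCast]
        exact S.mul_mem (S.mul_mem (S.pow_mem (S.neg_mem S.one_mem) _) (natCast_mem S k)) (h k)
      · rw [map_mul, map_mul, map_pow, map_neg, map_one, aeval_psum]
        simp only [Finset.mem_filter, Finset.HasAntidiagonal.mem_antidiagonal, Set.mem_Ioo] at ha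
        exact S.mul_mem (S.mul_mem (S.pow_mem (S.neg_mem S.one_mem) _) (h _)) (ih _ (by omega))

theorem esymm_mem_of_sum_pow_mem [CharZero F] (S : Subalgebra F L) (x : ι → L)
    (h : ∀ k, ∑ i, x i ^ k ∈ S) (k : ℕ) :
    MvPolynomial.aeval x (MvPolynomial.esymm ι L k) ∈ S := by
  classical
  induction k using Nat.strong_induction_on with
  | _ k ih =>
    rcases Nat.eq_zero_or_pos k with rfl | hk
    · simp
    · have hk0 : (k : F) ≠ 0 := by exact_mod_cast hk.ne'
      have h1 := congrArg (MvPolynomial.aeval x) (MvPolynomial.mul_esymm_eq_sum ι L k)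
      have h2 : (k : L) * MvPolynomial.aeval x (MvPolynomial.esymm ι L k) ∈ S := by
        rw [map_mul, map_natCast] at h1
        rw [h1, map_mul, map_pow, map_neg, map_one, map_sum]
        refine S.mul_mem (S.pow_mem (S.neg_mem S.one_mem) _) (S.sum_mem fun a ha => ?_)
        rw [map_mul, map_mul, map_pow, map_neg, map_one, aeval_psum]
        simp only [Finset.mem_filter, Finset.HasAntidiagonal.mem_antidiagonal] at ha
        exact S.mul_mem (S.mul_mem (S.pow_mem (S.neg_mem S.one_mem) _) (ih _ ha.2)) (h _)
      have h3 := S.smul_mem h2 ((k : F)⁻¹)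
      rwa [Algebra.smul_def, ← mul_assoc, ← map_natCast (algebraMap F L), ← map_mul,
        inv_mul_cancel₀ hk0, map_one, one_mul] at h3

theorem coeff_prod_X_sub_C (x : ι → L) (k : ℕ) (hk : k ≤ Fintype.card ι) :
    (∏ i, (X - C (x i))).coeff k = (-1) ^ (Fintype.card ι - k) *
      MvPolynomial.aeval x (MvPolynomial.esymm ι L (Fintype.card ι - k)) := by
  have := Multiset.prod_X_sub_C_coeff (Finset.univ.val.map x) (k := k) (by simpa using hk)
  rw [MvPolynomial.aeval_esymm_eq_multiset_esymm]
  simpa using this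

theorem map_sub_C_eq_prod (p : F[X]) (y : L) (x : ι → L) (hx : Function.Injective x)
    (hp : 0 < p.natDegree) (hcard : p.natDegree = Fintype.card ι) (h : ∀ i, aeval (x i) p = y) :
    p.map (algebraMap F L) - C y =
      C (algebraMap F L p.leadingCoeff) * ∏ i, (X - C (x i)) := by
  have hlead : algebraMap F L p.leadingCoeff ≠ 0 := by
    rw [Ne, FaithfulSMul.algebraMap_eq_zero_iff, leadingCoeff_eq_zero]
    rintro rfl
    simp at hp
  have hmonic : (∏ i, (X - C (x i))).Monic := monic_prod_of_monic _ _ fun i _ => monic_X_sub_C _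
  have hdeg1 : (p.map (algebraMap F L) - C y).natDegree = Fintype.card ι := by
    rw [natDegree_sub_C, natDegree_map, hcard]
  have hlc1 : (p.map (algebraMap F L) - C y).leadingCoeff = algebraMap F L p.leadingCoeff := by
    rw [leadingCoeff_sub_of_degree_lt, leadingCoeff_map]
    refine degree_C_le.trans_lt ?_
    rw [degree_map]
    exact natDegree_pos_iff_degree_pos.1 hp
  have hne1 : p.map (algebraMap F L) - C y ≠ 0 := by
    rw [← leadingCoeff_ne_zero, hlc1]
    exact hlead
  have hdeg2 : (C (algebraMap F L p.leadingCoeff) * ∏ i, (X - C (x i))).natDegree =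
      Fintype.card ι := by
    rw [natDegree_C_mul hlead, natDegree_prod_of_monic _ _ fun i _ => monic_X_sub_C _]
    simp
  have hne2 : C (algebraMap F L p.leadingCoeff) * ∏ i, (X - C (x i)) ≠ 0 :=
    mul_ne_zero (C_ne_zero.2 hlead) hmonic.ne_zero
  refine eq_of_degree_sub_lt_of_eval_index_eq (v := x) Finset.univ hx.injOn ?_ fun i _ => ?_
  · refine (degree_sub_lt_left ?_ hne1 ?_).trans_le ?_
    · rw [degree_eq_natDegree hne1, degree_eq_natDegree hne2, hdeg1, hdeg2]
    · rw [hlc1, leadingCoeff_mul, leadingCoeff_C, hmonic.leadingCoeff, mul_one]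
    · rw [degree_eq_natDegree hne1, hdeg1, Finset.card_univ]
  · rw [eval_sub, eval_C, eval_map_algebraMap, h, sub_self, eval_mul, eval_prod]
    rw [Finset.prod_eq_zero (Finset.mem_univ i) (by simp), mul_zero]

theorem esymm_mem (S : Subalgebra F L) (p : F[X]) (y : L) (hy : y ∈ S) (x : ι → L)
    (hx : Function.Injective x) (hp : 0 < p.natDegree) (hcard : p.natDegree = Fintype.card ι)
    (h : ∀ i, aeval (x i) p = y) (k : ℕ) :
    MvPolynomial.aeval x (MvPolynomial.esymm ι L k) ∈ S := by
  rcases lt_or_ge (Fintype.card ι) k with hk | hk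
  · rw [MvPolynomial.aeval_esymm_eq_multiset_esymm, Multiset.esymm,
      Multiset.powersetCard_eq_empty _ (by simpa using hk)]
    simp
  · have h1 := coeff_prod_X_sub_C x (Fintype.card ι - k) (Nat.sub_le _ _)
    rw [Nat.sub_sub_self hk] at h1
    have h2 := congrArg (fun q => q.coeff (Fintype.card ι - k))
      (map_sub_C_eq_prod p y x hx hp hcard h)
    simp only [coeff_C_mul, coeff_sub, coeff_map] at h2
    have hlead : p.leadingCoeff ≠ 0 := by
      rw [leadingCoeff_ne_zero]
      rintro rfl
      simp at hp
    have h3 : algebraMap F L p.leadingCoeff *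
        (∏ i, (X - C (x i))).coeff (Fintype.card ι - k) ∈ S := by
      rw [← h2]
      refine S.sub_mem (S.algebraMap_mem _) ?_
      rw [coeff_C]
      split_ifs
      · exact hy
      · exact S.zero_mem
    have h4 := S.smul_mem h3 (p.leadingCoeff⁻¹)
    rw [Algebra.smul_def, ← mul_assoc, ← map_mul, inv_mul_cancel₀ hlead, map_one, one_mul, h1] at h4
    have h5 := S.mul_mem (S.pow_mem (S.neg_mem S.one_mem) k) h4
    rwa [← mul_assoc, ← mul_pow, neg_one_mul, neg_neg, one_pow, one_mul] at h5

/-- Power sums of the full set of solutions of `p x = y` lie in any subalgebra containing `y`. -/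
theorem sum_pow_mem (S : Subalgebra F L) (p : F[X]) (y : L) (hy : y ∈ S) (x : ι → L)
    (hx : Function.Injective x) (hp : 0 < p.natDegree) (hcard : p.natDegree = Fintype.card ι)
    (h : ∀ i, aeval (x i) p = y) (k : ℕ) : ∑ i, x i ^ k ∈ S :=
  sum_pow_mem_of_esymm_mem S.toSubring x (esymm_mem S p y hy x hx hp hcard h) k

theorem mem_range_algebraMap_of_sum_pow_mem [IsAlgClosed F] [CharZero F] (v : ι → L)
    (h : ∀ k, ∑ i, v i ^ k ∈ (algebraMap F L).range) (i : ι) : v i ∈ (algebraMap F L).range := by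
  have h1 := esymm_mem_of_sum_pow_mem (⊥ : Subalgebra F L) v
    (fun k => Algebra.mem_bot.2 (h k))
  have h2 : ∏ i, (X - C (v i)) ∈ Polynomial.lifts (algebraMap F L) := by
    rw [Polynomial.lifts_iff_coeff_lifts]
    intro n
    rcases lt_or_ge (Fintype.card ι) n with hn | hn
    · rw [coeff_eq_zero_of_natDegree_lt]
      · exact ⟨0, map_zero _⟩
      · rw [natDegree_prod_of_monic _ _ fun i _ => monic_X_sub_C _]
        simpa using hn
    · rw [coeff_prod_X_sub_C v n hn]
      exact Algebra.mem_bot.1 ((⊥ : Subalgebra F L).mul_mem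
        (Subalgebra.pow_mem _ (Subalgebra.neg_mem _ (Subalgebra.one_mem _)) _) (h1 _))
  obtain ⟨q, hq⟩ := h2
  rw [coe_mapRingHom] at hq
  have hq0 : q ≠ 0 := by
    rintro rfl
    rw [Polynomial.map_zero] at hq
    exact (monic_prod_of_monic _ _ fun i _ => monic_X_sub_C (v i)).ne_zero hq.symm
  have hint : IsAlgebraic F (v i) := by
    refine ⟨q, hq0, ?_⟩
    rw [← eval_map_algebraMap, hq, eval_prod]
    exact Finset.prod_eq_zero (Finset.mem_univ i) (by simp)
  have hirr := minpoly.irreducible hint.isIntegral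
  exact minpoly.mem_range_of_degree_eq_one F (v i) (IsAlgClosed.degree_eq_one_of_irreducible F hirr)

theorem sum_pow_mem_range_of_isIntegralElem [CharZero F] (φ : F[X] →ₐ[F] L)
    (hφ : Function.Injective φ) (p : F[X]) (y : F[X]) (x : ι → L)
    (hx : Function.Injective x) (hp : 0 < p.natDegree) (hcard : p.natDegree = Fintype.card ι)
    (h : ∀ i, aeval (x i) p = φ y) (v : ι → L) (hv : ∀ i, φ.toRingHom.IsIntegralElem (v i))
    (hvx : ∀ k, ∑ i, v i * x i ^ k ∈ φ.range) (n : ℕ) : ∑ i, v i ^ n ∈ φ.range := by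
  have hlead : algebraMap F L p.leadingCoeff ≠ 0 := by
    rw [Ne, FaithfulSMul.algebraMap_eq_zero_iff, leadingCoeff_eq_zero]
    rintro rfl
    simp at hp
  let K := FractionRing F[X]
  let κ : K →+* L := IsFractionRing.lift (A := F[X]) (g := φ.toRingHom) hφ
  have hκ (q : F[X]) : κ (algebraMap F[X] K q) = φ q := IsFractionRing.lift_algebraMap _ _
  have hκF (c : F) : κ (algebraMap F K c) = algebraMap F L c := by
    rw [IsScalarTower.algebraMap_apply F F[X] K, hκ, AlgHom.commutes]
  have hκF' : κ.comp (algebraMap F K) = algebraMap F L := RingHom.ext hκF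
  have hpsum (k : ℕ) : ∑ i, x i ^ k ∈ κ.range := by
    obtain ⟨q, hq⟩ := sum_pow_mem φ.range p (φ y) ⟨y, rfl⟩ x hx hp hcard h k
    exact ⟨algebraMap F[X] K q, (hκ q).trans hq⟩
  choose m hm using hvx
  set Q : K[X] := p.map (algebraMap F K) - C (algebraMap F[X] K y) with hQ
  have hQκ : Q.map κ = C (algebraMap F L p.leadingCoeff) * ∏ i, (X - C (x i)) := by
    rw [← map_sub_C_eq_prod p (φ y) x hx hp hcard h, hQ, Polynomial.map_sub, map_C, hκ,
      Polynomial.map_map, hκF']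
  have hsep : Q.Separable := by
    rw [← separable_map κ, hQκ]
    exact (separable_prod_X_sub_C_iff.2 hx).unit_mul ((isUnit_C.2 hlead.isUnit))
  obtain ⟨a, b, hab⟩ := hsep
  have hQx (i : ι) : (Q.map κ).eval (x i) = 0 := by
    rw [hQκ, eval_mul, eval_prod, Finset.prod_eq_zero (Finset.mem_univ i) (by simp), mul_zero]
  have hb (i : ι) : (b.map κ).eval (x i) * aeval (x i) (derivative p) = 1 := by
    have h1 := congrArg (fun q => (q.map κ).eval (x i)) hab
    simp only [Polynomial.map_add, Polynomial.map_mul, eval_add, eval_mul, hQx, mul_zero, zero_add,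
      Polynomial.map_one, eval_one] at h1
    rw [← h1, hQ, derivative_sub, derivative_C, sub_zero, derivative_map, Polynomial.map_map, hκF',
      eval_map_algebraMap]
  set P : K[X] := ∑ k ∈ Finset.range (p.natDegree + 1), ∑ j ∈ Finset.range k,
    C (algebraMap F K (p.coeff k) * algebraMap F[X] K (m (k - 1 - j))) * X ^ j with hP
  have hPx (i : ι) : (P.map κ).eval (x i) = v i * aeval (x i) (derivative p) := by
    have h1 : (P.map κ).eval (x i) = ∑ l, v l * ∑ k ∈ Finset.range (p.natDegree + 1),
        algebraMap F L (p.coeff k) * ∑ j ∈ Finset.range k, x i ^ j * x l ^ (k - 1 - j) := by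
      rw [hP]
      simp only [Polynomial.map_sum, Polynomial.map_mul, map_C, Polynomial.map_pow, map_X,
        eval_finsetSum, eval_mul, eval_C, eval_pow, eval_X, map_mul, hκF, hκ, Finset.mul_sum]
      rw [Finset.sum_comm]
      refine Finset.sum_congr rfl fun k _ => ?_
      rw [Finset.sum_comm]
      refine Finset.sum_congr rfl fun j _ => ?_
      have : φ (m (k - 1 - j)) = ∑ i, v i * x i ^ (k - 1 - j) := hm _
      rw [this, Finset.mul_sum, Finset.sum_mul]
      refine Finset.sum_congr rfl fun l _ => ?_
      ring
    rw [h1, Finset.sum_eq_single i]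
    · congr 1
      rw [derivative_apply, sum_over_range _ (by simp), map_sum]
      refine Finset.sum_congr rfl fun k _ => ?_
      rw [map_mul, aeval_C, map_pow, aeval_X, map_mul, map_natCast, mul_assoc]
      congr 1
      rw [← Finset.card_range k, ← nsmul_eq_mul, ← Finset.sum_const, Finset.card_range]
      refine Finset.sum_congr rfl fun j hj => ?_
      rw [← pow_add]
      congr 1
      have := Finset.mem_range.1 hj
      omega
    · intro l _ hl
      have hne : x i - x l ≠ 0 := sub_ne_zero.2 fun h => hl (hx h).symm
      rw [mul_eq_zero]
      right
      apply mul_right_cancel₀ hne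
      rw [zero_mul, Finset.sum_mul, ← sub_self (φ y)]
      nth_rewrite 1 [← h i]
      rw [← h l, aeval_eq_sum_range, aeval_eq_sum_range, ← Finset.sum_sub_distrib]
      refine Finset.sum_congr rfl fun k _ => ?_
      rw [mul_assoc, geom_sum₂_mul, Algebra.smul_def, Algebra.smul_def, mul_sub]
    · intro h
      exact absurd (Finset.mem_univ i) h
  have hR (i : ι) : v i = ((b * P).map κ).eval (x i) := by
    rw [Polynomial.map_mul, eval_mul, hPx, mul_left_comm, hb, mul_one]
  have hmem : ∑ i, v i ^ n ∈ κ.range := by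
    have h1 (i : ι) : v i ^ n = ∑ k ∈ Finset.range (((b * P) ^ n).natDegree + 1),
        κ (((b * P) ^ n).coeff k) * x i ^ k := by
      rw [hR, ← eval_pow, ← Polynomial.map_pow, eval_map, eval₂_eq_sum_range]
    simp only [h1]
    rw [Finset.sum_comm]
    refine κ.range.sum_mem fun k _ => ?_
    rw [← Finset.mul_sum]
    exact κ.range.mul_mem ⟨_, rfl⟩ (hpsum k)
  obtain ⟨s, hs⟩ := hmem
  have hsint : φ.toRingHom.IsIntegralElem (κ s) := by
    rw [hs]
    refine Finset.sum_induction _ φ.toRingHom.IsIntegralElem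
      (fun a b => RingHom.IsIntegralElem.add _)
      (RingHom.isIntegralElem_zero _) fun i _ => ?_
    have hpow (n : ℕ) : φ.toRingHom.IsIntegralElem (v i ^ n) := by
      induction n with
      | zero => rw [pow_zero]; exact RingHom.isIntegralElem_one _
      | succ n ih => rw [pow_succ]; exact RingHom.IsIntegralElem.mul _ ih (hv i)
    exact hpow n
  have hsint' : IsIntegral F[X] s := by
    obtain ⟨q, hq, hq0⟩ := hsint
    refine ⟨q, hq, κ.injective ?_⟩
    rw [map_zero, ← hq0, hom_eval₂]
    congr 1
    exact RingHom.ext hκ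
  obtain ⟨q, hq⟩ := IsIntegrallyClosed.algebraMap_eq_of_integral hsint'
  exact ⟨q, by rw [← hs, ← hq]; exact (hκ q).symm⟩

end PowerSums

namespace LaurentOps

variable {F : Type} [Field F]

/-- A series `ψ` with `p(ψ) = ψ(t ^ N)`, together with all the solutions `ψ(ω t)` of
`g(X) = ζ g(ψ)`, whose set of scaling factors `ω` has the idempotent self-map `ω ↦ ω ^ N`. -/
structure Frame (F : Type) [Field F] (ι : Type) [Fintype ι] where
  ψ : LaurentSeries F
  b : F
  b_ne_zero : b ≠ 0
  isTop : IsTop ψ 1 b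
  N : ℕ
  N_pos : 0 < N
  p : F[X]
  natDegree_p : p.natDegree = N
  aeval_p : aeval ψ p = expand N N_pos ψ
  g : F[X]
  ζ : F
  ω : ι → Fˣ
  ω_injective : Function.Injective ω
  g_pos : 0 < g.natDegree
  natDegree_g : g.natDegree = Fintype.card ι
  aeval_g : ∀ i, aeval (scale (ω i) ψ) g = algebraMap F _ ζ * aeval ψ g
  σ : ι → ι
  ω_σ : ∀ i, ω (σ i) = ω i ^ N
  σ_σ : ∀ i, σ (σ i) = σ i

theorem scale_injective_left {ψ : LaurentSeries F} {b : F} (hψ : IsTop ψ 1 b) (hb : b ≠ 0) :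
    Function.Injective fun u : Fˣ => scale u ψ := by
  intro u v h
  have h1 := (hψ.scale u).2
  have h2 := (hψ.scale v).2
  simp only at h
  rw [h, h2] at h1
  exact Units.ext (by simpa [hb, eq_comm] using h1)

theorem isIntegralElem_of_aeval_eq (φ : F[X] →ₐ[F] LaurentSeries F) (p : F[X])
    (hp : 0 < p.natDegree) (z : LaurentSeries F) (r : F[X]) (h : aeval z p = φ r) :
    φ.toRingHom.IsIntegralElem z := by
  have hlead : p.leadingCoeff ≠ 0 := by
    rw [leadingCoeff_ne_zero]
    rintro rfl
    simp at hp
  set q : F[X][X] := (C p.leadingCoeff⁻¹ * p).map C - C (C p.leadingCoeff⁻¹ * r) with hq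
  have hmonic : ((C p.leadingCoeff⁻¹ * p).map (C : F →+* F[X])).Monic := by
    refine Monic.map _ ?_
    rw [Monic, leadingCoeff_mul, leadingCoeff_C, inv_mul_cancel₀ hlead]
  refine ⟨q, hmonic.sub_of_left ?_, ?_⟩
  · refine degree_C_le.trans_lt ?_
    rw [degree_map_eq_of_injective (C_injective), degree_C_mul (inv_ne_zero hlead)]
    exact natDegree_pos_iff_degree_pos.1 hp
  · have h1 : φ.toRingHom.comp C = algebraMap F (LaurentSeries F) :=
      RingHom.ext fun c => φ.commutes c
    rw [hq, eval₂_sub, eval₂_map, eval₂_C, h1, ← aeval_def, map_mul, h, aeval_C]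
    change _ - φ _ = 0
    rw [map_mul, sub_eq_zero]
    congr 1
    exact (φ.commutes _).symm

namespace Frame

variable {ι : Type} [Fintype ι] (D : Frame F ι)

noncomputable abbrev φ : F[X] →ₐ[F] LaurentSeries F := aeval D.ψ

noncomputable abbrev x (i : ι) : LaurentSeries F := scale (D.ω i) D.ψ

noncomputable abbrev V : LaurentSeries F →ₐ[F] LaurentSeries F := expand D.N D.N_pos

noncomputable abbrev U : LaurentSeries F →ₗ[F] LaurentSeries F := contract D.N D.N_pos

theorem φ_injective : Function.Injective D.φ :=
  aeval_injective_of_isTop D.isTop one_pos D.b_ne_zero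

theorem x_injective : Function.Injective D.x :=
  (scale_injective_left D.isTop D.b_ne_zero).comp D.ω_injective

theorem p_pos : 0 < D.p.natDegree := D.natDegree_p.symm ▸ D.N_pos

theorem aeval_p_x (i : ι) : aeval (D.x i) D.p = D.V (D.x (D.σ i)) := by
  rw [aeval_algHom_apply, D.aeval_p, scale_expand, x, D.ω_σ]

theorem aeval_g_x (i : ι) : aeval (D.x i) D.g = D.φ (C D.ζ * D.g) := by
  rw [map_mul, aeval_C, D.aeval_g]

theorem sum_aeval_mem (v : ι → LaurentSeries F) (τ : ι → ι)
    (hv : ∀ k, ∑ i, v i * D.x (τ i) ^ k ∈ D.φ.range) (q : F[X]) :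
    ∑ i, v i * aeval (D.x (τ i)) q ∈ D.φ.range := by
  simp only [aeval_eq_sum_range, Finset.mul_sum]
  rw [Finset.sum_comm]
  refine D.φ.range.sum_mem fun k _ => ?_
  simp only [mul_smul_comm]
  rw [← Finset.smul_sum]
  exact D.φ.range.smul_mem (hv k) _

theorem sum_pow_mem (k : ℕ) : ∑ i, D.x i ^ k ∈ D.φ.range :=
  PowerSums.sum_pow_mem D.φ.range D.g _ ⟨C D.ζ * D.g, rfl⟩ D.x D.x_injective D.g_pos
    D.natDegree_g D.aeval_g_x k

variable [IsAlgClosed F] [CharZero F]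

theorem contract_mem {a : LaurentSeries F} (ha : a ∈ D.φ.range) : D.U a ∈ D.φ.range := by
  obtain ⟨q, rfl⟩ := ha
  change D.U (aeval D.ψ q) ∈ _
  rw [aeval_eq_sum_range, map_sum]
  refine D.φ.range.sum_mem fun k _ => ?_
  rw [map_smul]
  refine D.φ.range.smul_mem ?_ _
  obtain ⟨μ, hμ⟩ := exists_units_isPrimitiveRoot (F := F) D.N D.N_pos
  have hN0 : (D.N : F) ≠ 0 := Nat.cast_ne_zero.2 D.N_pos.ne'
  have h1 : ∑ j : Fin D.N, scale (μ ^ (j : ℕ)) D.ψ ^ k ∈ D.φ.range.map D.V := by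
    refine PowerSums.sum_pow_mem (D.φ.range.map D.V) D.p (D.V D.ψ)
      ⟨D.ψ, ⟨X, aeval_X _⟩, rfl⟩ _ ?_ D.p_pos ?_ ?_ k
    · intro i j hij
      exact Fin.ext (hμ.pow_inj i.2 j.2 (scale_injective_left D.isTop D.b_ne_zero hij))
    · rw [D.natDegree_p, Fintype.card_fin]
    · intro j
      rw [aeval_algHom_apply, D.aeval_p, scale_expand, ← pow_mul, mul_comm, pow_mul, hμ.pow_eq_one,
        one_pow, scale_one]
  obtain ⟨a, ha, hVa⟩ := h1
  have h2 := nsmul_expand_contract D.N D.N_pos μ hμ (D.ψ ^ k)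
  simp only [map_pow] at h2
  rw [Finset.sum_range fun j => scale (μ ^ j) D.ψ ^ k, ← hVa] at h2
  change _ = D.V a at h2
  have h3 : D.U (D.ψ ^ k) = algebraMap F (LaurentSeries F) (D.N : F)⁻¹ * a := by
    apply expand_injective D.N D.N_pos
    rw [map_mul, AlgHom.commutes, ← h2, ← mul_assoc, ← map_natCast (algebraMap F (LaurentSeries F)),
      ← map_mul, inv_mul_cancel₀ hN0, map_one, one_mul]
  rw [h3]
  exact D.φ.range.mul_mem (D.φ.range.algebraMap_mem _) ha

theorem isIntegralElem_contract (i : ι) (hi : D.σ i = i) (k l : ℕ) :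
    D.φ.toRingHom.IsIntegralElem (D.U (D.x i ^ k * D.ψ ^ l)) := by
  obtain ⟨μ, hμ⟩ := exists_units_isPrimitiveRoot (F := F) D.N D.N_pos
  have hN0 : (D.N : F) ≠ 0 := Nat.cast_ne_zero.2 D.N_pos.ne'
  set φ' : F[X] →ₐ[F] LaurentSeries F := D.V.comp D.φ with hφ'
  have hV (j : ℕ) (a : LaurentSeries F) : scale (μ ^ j) (D.V a) = D.V a := by
    rw [scale_expand, ← pow_mul, mul_comm, pow_mul, hμ.pow_eq_one, one_pow, scale_one]
  have hy (j : ℕ) : φ'.toRingHom.IsIntegralElem (scale (μ ^ j) D.ψ) := by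
    refine isIntegralElem_of_aeval_eq φ' D.p D.p_pos _ X ?_
    rw [aeval_algHom_apply, D.aeval_p, hV, hφ', AlgHom.comp_apply, aeval_X]
  have hx (j : ℕ) : φ'.toRingHom.IsIntegralElem (scale (μ ^ j) (D.x i)) := by
    refine isIntegralElem_of_aeval_eq φ' (D.g.comp D.p) ?_ _ (C D.ζ * D.g) ?_
    · rw [natDegree_comp]
      exact Nat.mul_pos D.g_pos D.p_pos
    · rw [aeval_algHom_apply, aeval_comp, D.aeval_p_x, hi, aeval_algHom_apply, hV, hφ',
        AlgHom.comp_apply, D.aeval_g_x]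
  have hpow {z : LaurentSeries F} (hz : φ'.toRingHom.IsIntegralElem z) (n : ℕ) :
      φ'.toRingHom.IsIntegralElem (z ^ n) := by
    induction n with
    | zero => rw [pow_zero]; exact RingHom.isIntegralElem_one _
    | succ n ih => rw [pow_succ]; exact RingHom.IsIntegralElem.mul _ ih hz
  have hint : φ'.toRingHom.IsIntegralElem (D.V (D.U (D.x i ^ k * D.ψ ^ l))) := by
    have h1 : D.V (D.U (D.x i ^ k * D.ψ ^ l)) = φ' (C (D.N : F)⁻¹) *
        ∑ j ∈ Finset.range D.N, scale (μ ^ j) (D.x i ^ k * D.ψ ^ l) := by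
      rw [← nsmul_expand_contract D.N D.N_pos μ hμ, ← map_natCast (algebraMap F (LaurentSeries F)),
        ← mul_assoc]
      have : φ' (C (D.N : F)⁻¹) = algebraMap F (LaurentSeries F) (D.N : F)⁻¹ := φ'.commutes _
      rw [this, ← map_mul, inv_mul_cancel₀ hN0, map_one, one_mul]
    rw [h1]
    refine RingHom.IsIntegralElem.mul _ (RingHom.isIntegralElem_map (f := φ'.toRingHom)) ?_
    refine Finset.sum_induction _ φ'.toRingHom.IsIntegralElem
      (fun a b => RingHom.IsIntegralElem.add _) (RingHom.isIntegralElem_zero _) fun j _ => ?_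
    rw [map_mul, map_pow, map_pow]
    exact RingHom.IsIntegralElem.mul _ (hpow (hx j) k) (hpow (hy j) l)
  obtain ⟨q, hq, hq0⟩ := hint
  refine ⟨q, hq, expand_injective D.N D.N_pos ?_⟩
  rw [map_zero, ← hq0]
  exact hom_eval₂ q D.φ.toRingHom D.V.toRingHom _

/-- Constant weights on the image of `σ` against which all power sums of the `x i` are
polynomials in `ψ`. -/
def Balanced (w : ι → F) : Prop :=
  ∀ k, ∑ i, algebraMap F (LaurentSeries F) (w (D.σ i)) * D.x (D.σ i) ^ k ∈ D.φ.range

omit [IsAlgClosed F] [CharZero F] in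
theorem Balanced.sub_const_mul {D : Frame F ι} {w w' : ι → F} (h : D.Balanced w)
    (h' : D.Balanced w') (a : F) : D.Balanced fun i => w i - a * w' i := by
  intro k
  simp only [map_sub, map_mul, sub_mul, Finset.sum_sub_distrib, mul_assoc]
  rw [← Finset.mul_sum, ← Algebra.smul_def]
  exact D.φ.range.sub_mem (h k) (D.φ.range.smul_mem (h' k) a)

theorem balanced_one : D.Balanced fun _ => 1 := by
  intro k
  have h1 := D.sum_aeval_mem (fun _ => 1) id (by simpa using D.sum_pow_mem) (D.p ^ k)
  have h2 := D.contract_mem h1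
  rw [map_sum] at h2
  convert h2 using 2 with i
  rw [map_one, one_mul, one_mul, map_pow, id, D.aeval_p_x, ← map_pow D.V, contract_expand]

theorem Balanced.contract_mul {D : Frame F ι} {w : ι → F} (h : D.Balanced w) (k l r : ℕ) :
    ∑ i, (algebraMap F (LaurentSeries F) (w (D.σ i)) * D.U (D.x (D.σ i) ^ k * D.ψ ^ l)) *
      D.x (D.σ i) ^ r ∈ D.φ.range := by
  have h1 := D.sum_aeval_mem (fun i => algebraMap F (LaurentSeries F) (w (D.σ i))) D.σ h
    (D.p ^ r * X ^ k)
  have h2 := D.contract_mem (D.φ.range.mul_mem h1 (D.φ.range.pow_mem ⟨X, aeval_X _⟩ l))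
  rw [Finset.sum_mul, map_sum] at h2
  convert h2 using 2 with i
  have h3 : aeval (D.x (D.σ i)) (D.p ^ r * X ^ k) = D.V (D.x (D.σ i) ^ r) * D.x (D.σ i) ^ k := by
    rw [map_mul, map_pow, D.aeval_p_x, D.σ_σ, map_pow, aeval_X, map_pow]
  rw [h3, mul_assoc, mul_assoc, ← Algebra.smul_def, ← Algebra.smul_def, map_smul, mul_assoc,
    contract_expand_mul, mul_comm (D.U _)]

omit [IsAlgClosed F] [CharZero F] in
theorem exists_multiplicity : ∃ c : ι → ℕ, (∀ j, c j = 0 ↔ D.σ j ≠ j) ∧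
    ∀ f : ι → LaurentSeries F, ∑ i, f (D.σ i) = ∑ j, (c j : LaurentSeries F) * f j := by
  classical
  refine ⟨fun j => (Finset.univ.filter fun i => D.σ i = j).card, fun j => ?_, fun f => ?_⟩
  · simp only [Finset.card_eq_zero, Finset.filter_eq_empty_iff]
    constructor
    · exact fun h => h (Finset.mem_univ j)
    · rintro h i - rfl
      exact h (D.σ_σ i)
  · rw [← Finset.sum_fiberwise_of_maps_to (s := Finset.univ) (t := Finset.univ) (g := D.σ)
      (fun i _ => Finset.mem_univ _)]
    refine Finset.sum_congr rfl fun j _ => ?_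
    rw [← nsmul_eq_mul, ← Finset.sum_const]
    refine Finset.sum_congr rfl fun i hi => ?_
    rw [(Finset.mem_filter.1 hi).2]

theorem Balanced.mul_coeff {D : Frame F ι} {w : ι → F} (h : D.Balanced w) (k l : ℕ)
    (hkl : k + l < D.N) :
    D.Balanced fun i => w i * (D.x i ^ k * D.ψ ^ l).coeff 0 := by
  obtain ⟨c, hc, hsum⟩ := D.exists_multiplicity
  have hc0 (j : ι) (hj : D.σ j ≠ j) : c j = 0 := (hc j).2 hj
  have hc1 (j : ι) (hj : D.σ j = j) : (c j : F) ≠ 0 :=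
    Nat.cast_ne_zero.2 fun h0 => (hc j).1 h0 hj
  set v : ι → LaurentSeries F := fun j =>
    (c j : LaurentSeries F) * (algebraMap F _ (w j) * D.U (D.x j ^ k * D.ψ ^ l)) with hv
  have hvx (r : ℕ) : ∑ j, v j * D.x j ^ r ∈ D.φ.range := by
    have := h.contract_mul k l r
    rw [hsum fun j => (algebraMap F (LaurentSeries F) (w j) * D.U (D.x j ^ k * D.ψ ^ l)) *
      D.x j ^ r] at this
    simpa only [hv, mul_assoc] using this
  have hvint (j : ι) : D.φ.toRingHom.IsIntegralElem (v j) := by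
    by_cases hj : D.σ j = j
    · have h1 : v j = D.φ (C ((c j : F) * w j)) * D.U (D.x j ^ k * D.ψ ^ l) := by
        rw [hv, aeval_C, map_mul, map_natCast, mul_assoc]
      rw [h1]
      exact RingHom.IsIntegralElem.mul _ (RingHom.isIntegralElem_map (f := D.φ.toRingHom))
        (D.isIntegralElem_contract j hj k l)
    · rw [hv]
      simp only [hc0 j hj, Nat.cast_zero, zero_mul]
      exact RingHom.isIntegralElem_zero _
  have hUtop (j : ι) : IsTop (D.U (D.x j ^ k * D.ψ ^ l)) 0 ((D.x j ^ k * D.ψ ^ l).coeff 0) := by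
    refine (((D.isTop.scale (D.ω j)).pow k).mul (D.isTop.pow l)).contract_of_lt D.N D.N_pos ?_
    omega
  have hvtop (j : ι) : IsTop (v j) 0 (((c j : F) * w j) * (D.x j ^ k * D.ψ ^ l).coeff 0) := by
    have := (hUtop j).const_mul ((c j : F) * w j)
    rwa [map_mul, map_natCast, mul_assoc] at this
  have hconst (j : ι) : v j ∈ (algebraMap F (LaurentSeries F)).range := by
    refine PowerSums.mem_range_algebraMap_of_sum_pow_mem v (fun n => ?_) j
    obtain ⟨q, hq⟩ := PowerSums.sum_pow_mem_range_of_isIntegralElem D.φ D.φ_injective D.g _ D.x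
      D.x_injective D.g_pos D.natDegree_g D.aeval_g_x v hvint hvx n
    change aeval D.ψ q = _ at hq
    have h1 := IsTop.sum Finset.univ fun j _ => (hvtop j).pow n
    rw [mul_zero, ← hq] at h1
    have h2 := D.isTop.aeval one_pos q
    have h3 : q.natDegree = 0 := by
      by_contra hne
      have hq0 : q ≠ 0 := by
        rintro rfl
        simp at hne
      refine mul_ne_zero (leadingCoeff_ne_zero.2 hq0) (pow_ne_zero _ D.b_ne_zero)
        (((h1.lower ?_).eq_of h2).symm)
      rw [mul_one]
      exact_mod_cast Nat.pos_of_ne_zero hne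
    rw [← hq, eq_C_of_natDegree_eq_zero h3, aeval_C]
    exact ⟨_, rfl⟩
  have hval (j : ι) (hj : D.σ j = j) :
      algebraMap F (LaurentSeries F) (w j) * D.U (D.x j ^ k * D.ψ ^ l) =
        algebraMap F _ (w j * (D.x j ^ k * D.ψ ^ l).coeff 0) := by
    obtain ⟨a, ha⟩ := hconst j
    have h1 : a = (c j : F) * w j * (D.x j ^ k * D.ψ ^ l).coeff 0 := by
      have h2 := (hvtop j).2
      rwa [← ha, neg_zero, coeff_algebraMap_zero] at h2
    have hcL : (c j : LaurentSeries F) ≠ 0 := by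
      exact_mod_cast hc1 j hj
    apply mul_left_cancel₀ hcL
    change v j = _
    rw [← ha, h1, mul_assoc, map_mul, map_natCast]
  intro r
  have := h.contract_mul k l r
  simpa only [hval _ (D.σ_σ _)] using this

end Frame

theorem IsTop.pow_sub_pow {a τ : LaurentSeries F} {r : ℤ} {c γ : F} (ha : IsTop a 1 c)
    (hτ : IsTop τ 1 c) (h : IsTop (a - τ) (-r) γ) (k : ℕ) :
    IsTop (a ^ (k + 1) - τ ^ (k + 1)) (k - r) ((k + 1) * c ^ k * γ) := by
  induction k with
  | zero => simpa using h
  | succ k ih =>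
    have h1 : IsTop (a * (a ^ (k + 1) - τ ^ (k + 1))) ((k + 1 : ℕ) - r)
        (c * ((k + 1) * c ^ k * γ)) := by
      convert ha.mul ih using 1
      push_cast
      ring
    have h2 : IsTop ((a - τ) * τ ^ (k + 1)) ((k + 1 : ℕ) - r) (γ * c ^ (k + 1)) := by
      convert h.mul (hτ.pow (k + 1)) using 1
      ring
    convert h1.add h2 using 1
    · ring
    · push_cast
      ring

theorem coeff_zero_scale_pow_mul_pow {ψ : LaurentSeries F} {b γ : F} {r : ℕ} (hψ : IsTop ψ 1 b)
    (h : IsTop (ψ - HahnSeries.single (-1) b) (-r) γ) (u : Fˣ) (k l : ℕ) (hkl : k + l + 1 = r) :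
    (scale u ψ ^ (k + 1) * ψ ^ (l + 1)).coeff 0 =
      b ^ r * γ * ((l + 1) * (u : F) ^ (k + 1) + (k + 1) * (u : F) ^ k * (u⁻¹ : F) ^ r) := by
  have hsingle (c : F) : IsTop (HahnSeries.single (-1 : ℤ) c) 1 c :=
    ⟨fun i hi => HahnSeries.coeff_single_of_ne (by omega), HahnSeries.coeff_single_same _ _⟩
  have hscale : scale u (HahnSeries.single (-1 : ℤ) b) =
      HahnSeries.single (-1 : ℤ) ((u : F) * b) := by
    ext n
    by_cases hn : n = -1
    · subst hn
      simp
    · rw [coeff_scale, HahnSeries.coeff_single_of_ne hn, HahnSeries.coeff_single_of_ne hn, mul_zero]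
  have hx : IsTop (scale u ψ) 1 (u * b) := by simpa using hψ.scale u
  have hx' : IsTop (scale u ψ - HahnSeries.single (-1 : ℤ) ((u : F) * b)) (-r)
      ((u⁻¹ : F) ^ r * γ) := by
    rw [← hscale, ← map_sub]
    simpa using h.scale u
  have h1 := hx.pow_sub_pow (hsingle _) hx' k
  have h2 := hψ.pow_sub_pow (hsingle _) h l
  have h4 : (((k + 1 : ℕ) : ℤ) * 1 + (l - r)) = 0 := by omega
  have h5 : ((k - r : ℤ) + ((l + 1 : ℕ) : ℤ) * 1) = 0 := by omega
  have h6 := (hx.pow (k + 1)).mul h2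
  rw [h4] at h6
  have h7 := h1.mul ((hsingle b).pow (l + 1))
  rw [h5] at h7
  have h8 := (h6.add h7).2
  have h9 : (HahnSeries.single (-1 : ℤ) ((u : F) * b) ^ (k + 1) *
      HahnSeries.single (-1 : ℤ) b ^ (l + 1)).coeff 0 = 0 := by
    rw [HahnSeries.single_pow, HahnSeries.single_pow, HahnSeries.single_mul_single]
    refine HahnSeries.coeff_single_of_ne ?_
    simp only [nsmul_eq_mul]
    push_cast
    omega
  have h10 : scale u ψ ^ (k + 1) * ψ ^ (l + 1) =
      (scale u ψ ^ (k + 1) * (ψ ^ (l + 1) - HahnSeries.single (-1 : ℤ) b ^ (l + 1)) +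
        (scale u ψ ^ (k + 1) - HahnSeries.single (-1 : ℤ) ((u : F) * b) ^ (k + 1)) *
          HahnSeries.single (-1 : ℤ) b ^ (l + 1)) +
      HahnSeries.single (-1 : ℤ) ((u : F) * b) ^ (k + 1) *
        HahnSeries.single (-1 : ℤ) b ^ (l + 1) := by ring
  rw [neg_zero] at h8
  rw [h10, HahnSeries.coeff_add, h9, h8, ← hkl]
  ring

theorem exists_isTop_sub_single {ψ : LaurentSeries F} {b : F} (hψ : IsTop ψ 1 b)
    (hψ0 : ψ.coeff 0 = 0) (hne : ψ ≠ HahnSeries.single (-1) b) :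
    ∃ r : ℕ, 1 ≤ r ∧ ∃ γ, γ ≠ 0 ∧ IsTop (ψ - HahnSeries.single (-1) b) (-r) γ := by
  obtain ⟨n, γ, hγ, htop⟩ := exists_isTop (sub_ne_zero.2 hne)
  have hn : n < 0 := by
    by_contra hn
    apply hγ
    rw [← htop.2, HahnSeries.coeff_sub]
    rcases lt_trichotomy n 1 with h | rfl | h
    · obtain rfl : n = 0 := by omega
      rw [neg_zero, hψ0, HahnSeries.coeff_single_of_ne (by norm_num), sub_zero]
    · rw [hψ.2, HahnSeries.coeff_single_same, sub_self]
    · rw [hψ.1 n h, HahnSeries.coeff_single_of_ne (by omega), sub_zero]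
  exact ⟨n.natAbs, by omega, γ, hγ, by convert htop using 1; omega⟩

theorem natCast_add_ne_zero_of_pow_eq_one [CharZero F] {V : F} {M r : ℕ} (hr : 2 ≤ r) (hM : 0 < M)
    (hV : V ^ M = 1) : (r : F) + V ≠ 0 := by
  intro h
  have h1 : V = -(r : F) := by linear_combination h
  have h2 : ((r : F) ^ M) ^ 2 = 1 := by
    rw [h1] at hV
    rw [← pow_mul, mul_comm, pow_mul, ← neg_sq, ← pow_mul, mul_comm, pow_mul, hV, one_pow]
  have h3 : (r ^ M) ^ 2 = 1 := by exact_mod_cast h2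
  have h4 : 1 < r ^ M := Nat.one_lt_pow hM.ne' hr
  nlinarith

theorem eq_of_weighted_eq [CharZero F] {r a b V W V' W' : F} (hr0 : r ≠ 0) (hr1 : r - 1 ≠ 0)
    (ha : a ≠ 0) (hb : b ≠ 0) (hrV : r + V ≠ 0) (hV : V * V' = 1) (hW : W * W' = 1)
    (h1 : a * (r + V) = b * (r + W)) (h2 : a ^ 2 * (r - 1 + 2 * V) = b ^ 2 * (r - 1 + 2 * W))
    (h3 : b * (r + V') = a * (r + W')) : a = b := by
  have key : V = W → a = b := by
    rintro rfl
    exact mul_right_cancel₀ hrV h1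
  have h4 : V + V' = W + W' := by
    have h5 : (a * b * r) * (V + V') = (a * b * r) * (W + W') := by
      linear_combination (b * (r + V')) * h1 + (b * (r + W)) * h3 - a * b * hV + a * b * hW
    exact mul_left_cancel₀ (mul_ne_zero (mul_ne_zero ha hb) hr0) h5
  have h6 : (V - W) * (V * W - 1) = 0 := by
    linear_combination V * W * h4 - W * hV + V * hW
  rcases mul_eq_zero.1 h6 with h | h
  · exact key (sub_eq_zero.1 h)
  have hVW : V * W = 1 := by linear_combination h
  have h7 : b ^ 2 * ((r - 1 + 2 * V) * (r + W) ^ 2 - (r + V) ^ 2 * (r - 1 + 2 * W)) = 0 := by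
    linear_combination (r + V) ^ 2 * h2 - (r - 1 + 2 * V) * (a * (r + V) + b * (r + W)) * h1
  have h8 : (r - 1 + 2 * V) * (r + W) ^ 2 - (r + V) ^ 2 * (r - 1 + 2 * W) = 0 :=
    (mul_eq_zero.1 h7).resolve_left (pow_ne_zero _ hb)
  have h9 : (r - 1) * (V - W) * (V + W - 2) = 0 := by
    linear_combination (-1 : F) * h8 + 2 * (W - V) * hVW
  rcases mul_eq_zero.1 h9 with h | h
  · exact key (sub_eq_zero.1 ((mul_eq_zero.1 h).resolve_left hr1))
  · apply key
    have : (V - W) ^ 2 = 0 := by linear_combination (V + W + 2) * h - 4 * hVW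
    exact sub_eq_zero.1 (pow_eq_zero_iff two_ne_zero |>.1 this)

theorem units_eq_of_weighted_eq [CharZero F] {r M : ℕ} (hr : 2 ≤ r) (hM : 0 < M) {u v : Fˣ}
    (hu : u ^ M = 1)
    (h : ∀ k l : ℕ, k + l + 1 = r →
      (l + 1) * (u : F) ^ (k + 1) + (k + 1) * (u : F) ^ k * (u⁻¹ : F) ^ r =
        (l + 1) * (v : F) ^ (k + 1) + (k + 1) * (v : F) ^ k * (v⁻¹ : F) ^ r) : u = v := by
  obtain ⟨s, rfl⟩ := Nat.exists_eq_add_of_le' hr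
  have hu0 := u.ne_zero
  have hv0 := v.ne_zero
  have h1 := h 0 (s + 1) (by omega)
  have h2 := h 1 s (by omega)
  have h3 := h (s + 1) 0 (by omega)
  have hV (w : Fˣ) : (w⁻¹ : F) ^ (s + 3) * (w : F) ^ (s + 3) = 1 := by
    rw [← mul_pow, inv_mul_cancel₀ w.ne_zero, one_pow]
  refine Units.ext (eq_of_weighted_eq (r := ((s + 2 : ℕ) : F)) (V := (u⁻¹ : F) ^ (s + 3))
    (W := (v⁻¹ : F) ^ (s + 3)) ?_ ?_ hu0 hv0
    (natCast_add_ne_zero_of_pow_eq_one hr hM ?_) (hV u) (hV v) ?_ ?_ ?_)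
  · exact Nat.cast_ne_zero.2 (by omega)
  · have : ((s + 2 : ℕ) : F) - 1 = ((s + 1 : ℕ) : F) := by push_cast; ring
    rw [this]
    exact Nat.cast_ne_zero.2 (by omega)
  · rw [← pow_mul, mul_comm, pow_mul, inv_pow, ← Units.val_pow_eq_pow_val, hu, Units.val_one,
      inv_one, one_pow]
  · have hw (w : Fˣ) : (w : F) * (((s + 2 : ℕ) : F) + (w⁻¹ : F) ^ (s + 3)) =
        ((s + 1 : ℕ) + 1) * (w : F) ^ (0 + 1) +
          ((0 : ℕ) + 1) * (w : F) ^ 0 * (w⁻¹ : F) ^ (s + 2) := by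
      have h4 := mul_inv_cancel₀ w.ne_zero
      push_cast
      linear_combination (w⁻¹ : F) ^ (s + 2) * h4
    rw [hw, hw, h1]
  · have hw (w : Fˣ) : (w : F) ^ 2 * (((s + 2 : ℕ) : F) - 1 + 2 * (w⁻¹ : F) ^ (s + 3)) =
        ((s : ℕ) + 1) * (w : F) ^ (1 + 1) + ((1 : ℕ) + 1) * (w : F) ^ 1 * (w⁻¹ : F) ^ (s + 2) := by
      have h4 := mul_inv_cancel₀ w.ne_zero
      push_cast
      linear_combination 2 * (w : F) * (w⁻¹ : F) ^ (s + 2) * h4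
    rw [hw, hw, h2]
  · have hw (w : Fˣ) : (w⁻¹ : F) * (((s + 2 : ℕ) : F) + (w : F) ^ (s + 3)) =
        ((0 : ℕ) + 1) * (w : F) ^ (s + 1 + 1) +
          ((s + 1 : ℕ) + 1) * (w : F) ^ (s + 1) * (w⁻¹ : F) ^ (s + 2) := by
      have h4 := mul_inv_cancel₀ w.ne_zero
      have h5 : (w : F) ^ (s + 1) * (w⁻¹ : F) ^ (s + 1) = 1 := by rw [← mul_pow, h4, one_pow]
      push_cast
      linear_combination (w : F) ^ (s + 2) * h4 - (s + 2) * (w⁻¹ : F) * h5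
    have h4 : (u⁻¹ : F) * (((s + 2 : ℕ) : F) + (u : F) ^ (s + 3)) =
        (v⁻¹ : F) * (((s + 2 : ℕ) : F) + (v : F) ^ (s + 3)) := by
      rw [hw, hw, h3]
    field_simp at h4
    linear_combination h4

theorem units_eq_or_eq_inv {u v : Fˣ} (h : (u : F) + (u⁻¹ : F) = v + (v⁻¹ : F)) :
    u = v ∨ u = v⁻¹ := by
  have hu0 := u.ne_zero
  have hv0 := v.ne_zero
  have h1 : ((u : F) - v) * (u * v - 1) = 0 := by
    field_simp at h
    linear_combination h
  rcases mul_eq_zero.1 h1 with h | h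
  · exact Or.inl (Units.ext (sub_eq_zero.1 h))
  · refine Or.inr (eq_inv_of_mul_eq_one_left (Units.ext ?_))
    rw [Units.val_mul, Units.val_one]
    exact sub_eq_zero.1 h

theorem exists_natDegree_le_of_mem_range {ψ a : LaurentSeries F} {b c : F} (hψ : IsTop ψ 1 b)
    (hb : b ≠ 0) {n : ℕ} (ha : IsTop a n c)
    (h : a ∈ (aeval ψ : F[X] →ₐ[F] LaurentSeries F).range) :
    ∃ q : F[X], q.natDegree ≤ n ∧ aeval ψ q = a := by
  obtain ⟨q, hq⟩ := h
  change aeval ψ q = a at hq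
  refine ⟨q, ?_, hq⟩
  by_contra! hlt
  have hq0 : q ≠ 0 := by
    rintro rfl
    simp at hlt
  have h1 := hψ.aeval one_pos q
  rw [hq] at h1
  refine mul_ne_zero (leadingCoeff_ne_zero.2 hq0) (pow_ne_zero _ hb) (((ha.lower ?_).eq_of h1).symm)
  rw [mul_one]
  exact_mod_cast hlt

theorem eq_algebraMap_mul_of_mem_range {ψ a : LaurentSeries F} {b c : F} (hψ : IsTop ψ 1 b)
    (hb : b ≠ 0) (hψ0 : ψ.coeff 0 = 0) (ha : IsTop a 1 (c * b)) (ha0 : a.coeff 0 = 0)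
    (h : a ∈ (aeval ψ : F[X] →ₐ[F] LaurentSeries F).range) :
    a = algebraMap F _ c * ψ := by
  obtain ⟨q, hq, rfl⟩ := exists_natDegree_le_of_mem_range hψ hb (n := 1) (by simpa using ha) h
  obtain ⟨u, v, rfl⟩ := exists_eq_X_add_C_of_natDegree_le_one hq
  simp only [map_add, map_mul, aeval_C, aeval_X] at ha ha0 ⊢
  have hv : v = 0 := by
    rw [HahnSeries.coeff_add, coeff_algebraMap_zero, ← Algebra.smul_def] at ha0
    simpa [hψ0] using ha0
  subst hv
  rw [map_zero, add_zero] at ha ⊢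
  rw [mul_right_cancel₀ hb (ha.eq_of (hψ.const_mul u))]

namespace Frame

variable {ι : Type} [Fintype ι] (D : Frame F ι) [IsAlgClosed F] [CharZero F]

theorem exists_balanced_eq_zero (i₀ : ι) (s : Finset ι)
    (h : ∀ j ∈ s, ∃ k l, k + l < D.N ∧
      (D.x j ^ k * D.ψ ^ l).coeff 0 ≠ (D.x i₀ ^ k * D.ψ ^ l).coeff 0) :
    ∃ w, D.Balanced w ∧ w i₀ ≠ 0 ∧ ∀ j ∈ s, w j = 0 := by
  classical
  induction s using Finset.induction_on with
  | empty => exact ⟨_, D.balanced_one, one_ne_zero, by simp⟩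
  | insert j s hj ih =>
    obtain ⟨w, hw, hw0, hws⟩ := ih fun i hi => h i (Finset.mem_insert_of_mem hi)
    obtain ⟨k, l, hkl, hne⟩ := h j (Finset.mem_insert_self _ _)
    refine ⟨_, (hw.mul_coeff k l hkl).sub_const_mul hw ((D.x j ^ k * D.ψ ^ l).coeff 0), ?_, ?_⟩
    · rw [mul_comm, ← sub_mul]
      exact mul_ne_zero (sub_ne_zero.2 hne.symm) hw0
    · intro i hi
      rcases Finset.mem_insert.1 hi with rfl | hi
      · ring
      · simp [hws i hi]

theorem exists_linear_or_pair [Nonempty ι] (hψ0 : D.ψ.coeff 0 = 0) {r : ℕ} (hr : 1 ≤ r) {γ : F}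
    (hγ : γ ≠ 0) (htop : IsTop (D.ψ - HahnSeries.single (-1) D.b) (-r) γ) (hrN : r + 1 < D.N) :
    ∃ i, D.σ i = i ∧ (D.x i = algebraMap F _ (D.ω i : F) * D.ψ ∨
      r = 1 ∧ (D.ω i)⁻¹ ≠ D.ω i ∧ ∃ w₁ w₂ : F, w₁ ≠ 0 ∧
        ∀ k, algebraMap F _ w₁ * D.x i ^ k + algebraMap F _ w₂ * scale (D.ω i)⁻¹ D.ψ ^ k ∈
          D.φ.range) := by
  classical
  obtain ⟨i₁⟩ := ‹Nonempty ι›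
  set i := D.σ i₁ with hi
  have hσi : D.σ i = i := D.σ_σ i₁
  refine ⟨i, hσi, ?_⟩
  obtain ⟨c, hc, hsum⟩ := D.exists_multiplicity
  have hroot : D.ω i ^ (D.N - 1) = 1 := by
    have h1 := D.ω_σ i
    rw [hσi, show D.N = (D.N - 1) + 1 by omega, pow_succ] at h1
    simpa using h1
  set s : Finset ι := Finset.univ.filter fun j =>
    D.ω j ≠ D.ω i ∧ (r = 1 → D.ω j ≠ (D.ω i)⁻¹) with hs
  obtain ⟨w, hw, hwi, hws⟩ := D.exists_balanced_eq_zero i s (by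
    intro j hj
    by_contra! hcon
    obtain ⟨h1, h2⟩ := (Finset.mem_filter.1 hj).2
    have hK : D.b ^ r * γ ≠ 0 := mul_ne_zero (pow_ne_zero _ D.b_ne_zero) hγ
    have h3 (k l : ℕ) (hkl : k + l + 1 = r) := mul_left_cancel₀ hK
      (((coeff_zero_scale_pow_mul_pow D.isTop htop (D.ω i) k l hkl).symm.trans
        (hcon (k + 1) (l + 1) (by omega)).symm).trans
        (coeff_zero_scale_pow_mul_pow D.isTop htop (D.ω j) k l hkl))
    rcases hr.eq_or_lt with rfl | hr2
    · have h4 := h3 0 0 rfl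
      have h5 : ((D.ω i : Fˣ) : F) + (D.ω i : F)⁻¹ = D.ω j + (D.ω j : F)⁻¹ := by simpa using h4
      rcases units_eq_or_eq_inv h5.symm with h | h
      · exact h1 h
      · exact h2 rfl h
    · exact h1 (units_eq_of_weighted_eq hr2 (by omega) hroot h3).symm)
  have hbal (k : ℕ) : ∑ j, (c j : LaurentSeries F) * (algebraMap F (LaurentSeries F) (w j) *
      D.x j ^ k) ∈ D.φ.range := by
    rw [← hsum fun j => algebraMap F (LaurentSeries F) (w j) * D.x j ^ k]
    exact hw k
  have hci : (c i : F) ≠ 0 := Nat.cast_ne_zero.2 fun h0 => (hc i).1 h0 hσi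
  have hcwi : (c i : F) * w i ≠ 0 := mul_ne_zero hci hwi
  by_cases hcase : ∀ j, j ≠ i → D.σ j = j → w j = 0
  · left
    have h1 := hbal 1
    rw [Finset.sum_eq_single i (fun j _ hj => by
      by_cases hσ : D.σ j = j
      · rw [hcase j hj hσ, map_zero, zero_mul, mul_zero]
      · rw [(hc j).2 hσ, Nat.cast_zero, zero_mul]) (fun h => absurd (Finset.mem_univ i) h), pow_one,
      ← mul_assoc, ← map_natCast (algebraMap F (LaurentSeries F)), ← map_mul] at h1
    have h2 := D.φ.range.mul_mem (D.φ.range.algebraMap_mem ((c i : F) * w i)⁻¹) h1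
    rw [← mul_assoc, ← map_mul, inv_mul_cancel₀ hcwi, map_one, one_mul] at h2
    refine eq_algebraMap_mul_of_mem_range D.isTop D.b_ne_zero hψ0 ?_ ?_ h2
    · simpa using D.isTop.scale (D.ω i)
    · rw [coeff_scale, hψ0, mul_zero]
  · push Not at hcase
    obtain ⟨j, hji, hσj, hwj⟩ := hcase
    have hj : j ∉ s := fun h => hwj (hws j h)
    have hωne : D.ω j ≠ D.ω i := fun h => hji (D.ω_injective h)
    have hj2 : r = 1 ∧ D.ω j = (D.ω i)⁻¹ := by
      by_contra hcon
      exact hj (Finset.mem_filter.2 ⟨Finset.mem_univ _, hωne, fun h1 h2 => hcon ⟨h1, h2⟩⟩)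
    right
    refine ⟨hj2.1, hj2.2 ▸ hωne, (c i : F) * w i, (c j : F) * w j, hcwi, fun k => ?_⟩
    have h1 := hbal k
    rw [Finset.sum_eq_add i j hji.symm (fun l _ hl => by
      by_cases hσ : D.σ l = l
      · rw [hws l (Finset.mem_filter.2 ⟨Finset.mem_univ _, fun h => hl.1 (D.ω_injective h),
          fun _ h => hl.2 (D.ω_injective (h.trans hj2.2.symm))⟩), map_zero, zero_mul, mul_zero]
      · rw [(hc l).2 hσ, Nat.cast_zero, zero_mul]) (fun h => absurd (Finset.mem_univ i) h)
      (fun h => absurd (Finset.mem_univ j) h)] at h1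
    rw [map_mul, map_natCast, map_mul, map_natCast, mul_assoc, mul_assoc, ← hj2.2]
    exact h1

end Frame

theorem exists_pow_sub_pow_eq {R : Type*} [CommRing R] [Algebra F R] (A : Subalgebra F R) {x y : R}
    (hs : x + y ∈ A) (hp : x * y ∈ A) (q : F[X]) :
    ∃ r ∈ A, aeval x q - aeval y q = (x - y) * r := by
  have key (k : ℕ) : (∃ r ∈ A, x ^ k - y ^ k = (x - y) * r) ∧
      ∃ r ∈ A, x ^ (k + 1) - y ^ (k + 1) = (x - y) * r := by
    induction k with
    | zero => exact ⟨⟨0, A.zero_mem, by simp⟩, ⟨1, A.one_mem, by simp⟩⟩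
    | succ k ih =>
      obtain ⟨⟨r₁, hr₁, h₁⟩, r₂, hr₂, h₂⟩ := ih
      refine ⟨⟨r₂, hr₂, h₂⟩, (x + y) * r₂ - x * y * r₁,
        A.sub_mem (A.mul_mem hs hr₂) (A.mul_mem hp hr₁), ?_⟩
      linear_combination (x + y) * h₂ - x * y * h₁
  choose r hr h using fun k => (key k).1
  refine ⟨∑ k ∈ Finset.range (q.natDegree + 1), q.coeff k • r k,
    A.sum_mem fun k _ => A.smul_mem (hr k) _, ?_⟩
  rw [aeval_eq_sum_range, aeval_eq_sum_range, ← Finset.sum_sub_distrib, Finset.mul_sum]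
  refine Finset.sum_congr rfl fun k _ => ?_
  rw [← smul_sub, h, mul_smul_comm]

theorem scale_pow_eq {u : Fˣ} {c : F} {a : LaurentSeries F}
    (h : scale u a = algebraMap F _ c * a) (k : ℕ) :
    scale (u ^ k) a = algebraMap F _ (c ^ k) * a := by
  induction k with
  | zero => simp [scale_one]
  | succ k ih =>
    rw [pow_succ, ← scale_scale, h, map_mul, AlgHom.commutes, ih, ← mul_assoc, ← map_mul, pow_succ,
      mul_comm c]

theorem scale_inv_eq {u v : Fˣ} {a : LaurentSeries F}
    (h : scale u a = algebraMap F _ (v : F) * a) :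
    scale u⁻¹ a = algebraMap F _ ((v⁻¹ : Fˣ) : F) * a := by
  apply scale_injective u
  rw [scale_scale, mul_inv_cancel, scale_one, map_mul, AlgHom.commutes, h, ← mul_assoc, ← map_mul,
    ← Units.val_mul, inv_mul_cancel, Units.val_one, map_one, one_mul]

theorem eq_weights_of_mem_range [CharZero F] {ψ : LaurentSeries F} {b : F} (hb : b ≠ 0)
    (hψ : IsTop ψ 1 b) (hψ0 : ψ.coeff 0 = 0) (hγ : ψ.coeff 1 ≠ 0) {u : Fˣ} (hu : u⁻¹ ≠ u)
    {w₁ w₂ : F} (h : algebraMap F _ w₁ * scale u ψ + algebraMap F _ w₂ * scale u⁻¹ ψ ∈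
      (aeval ψ : F[X] →ₐ[F] LaurentSeries F).range) :
    w₁ = w₂ ∧ algebraMap F _ w₁ * (scale u ψ + scale u⁻¹ ψ) =
      algebraMap F _ (w₁ * (u + (u⁻¹ : F))) * ψ := by
  have htop : IsTop (algebraMap F _ w₁ * scale u ψ + algebraMap F _ w₂ * scale u⁻¹ ψ) 1
      ((w₁ * u + w₂ * (u⁻¹ : F)) * b) := by
    convert ((hψ.scale u).const_mul w₁).add ((hψ.scale u⁻¹).const_mul w₂) using 1
    simp
    ring
  have h0 : (algebraMap F (LaurentSeries F) w₁ * scale u ψ +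
      algebraMap F _ w₂ * scale u⁻¹ ψ).coeff 0 = 0 := by
    simp [← Algebra.smul_def, hψ0]
  have h1 := eq_algebraMap_mul_of_mem_range hψ hb hψ0 htop h0 h
  have h2 := congrArg (fun a => a.coeff 1) h1
  simp only [← Algebra.smul_def, HahnSeries.coeff_add, HahnSeries.coeff_smul, coeff_scale,
    smul_eq_mul, zpow_neg, zpow_one, inv_inv, Units.val_inv_eq_inv_val] at h2
  have hu0 := u.ne_zero
  have hu2 : (u⁻¹ : F) - u ≠ 0 := by
    rw [sub_ne_zero, ← Units.val_inv_eq_inv_val]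
    exact fun h => hu (Units.ext h)
  have h3 : w₁ = w₂ := by
    have h4 : ((w₁ - w₂) * ((u⁻¹ : F) - u)) * ψ.coeff 1 = 0 := by linear_combination h2
    exact sub_eq_zero.1 ((mul_eq_zero.1 ((mul_eq_zero.1 h4).resolve_right hγ)).resolve_right hu2)
  refine ⟨h3, ?_⟩
  rw [mul_add]
  nth_rewrite 2 [h3]
  rw [h1, h3]
  congr 2
  ring

/-- If `ψ(u t)` and `ψ(t / u)` are conjugate over `F[ψ]`, then `f` satisfies a Pell equation. -/
theorem exists_sq_sub_eq [CharZero F] {ψ : LaurentSeries F} {b : F} (hb : b ≠ 0)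
    (hψ : IsTop ψ 1 b) (hψ0 : ψ.coeff 0 = 0) (hγ : ψ.coeff 1 ≠ 0) {f : F[X]} {d m : ℕ} (hd : 0 < d)
    (hf : aeval ψ f = expand d hd ψ) {u : Fˣ} (hu : u⁻¹ ≠ u) (hm : 1 ≤ m) (hum : u ^ d ^ m = u)
    {w₁ w₂ : F} (hw₁ : w₁ ≠ 0) (h : ∀ k, algebraMap F _ w₁ * scale u ψ ^ k +
      algebraMap F _ w₂ * scale u⁻¹ ψ ^ k ∈ (aeval ψ : F[X] →ₐ[F] LaurentSeries F).range) :
    ∃ β : F, β ≠ 0 ∧ ∃ r : F[X], f ^ 2 - C (4 * β) = r ^ 2 * (X ^ 2 - C (4 * β)) := by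
  set A := (aeval ψ : F[X] →ₐ[F] LaurentSeries F).range with hA
  set κ := algebraMap F (LaurentSeries F) with hκ
  have hinj : Function.Injective κ := FaithfulSMul.algebraMap_injective F (LaurentSeries F)
  set x := scale u ψ with hx
  set y := scale u⁻¹ ψ with hy
  obtain ⟨rfl, h1⟩ := eq_weights_of_mem_range hb hψ hψ0 hγ hu
    (by have h' := h 1; rwa [pow_one, pow_one] at h')
  have hκw : κ w₁ ≠ 0 := (map_ne_zero κ).2 hw₁
  set U := κ u with hU
  set U' := κ (u⁻¹ : F) with hU'
  have hUU : U * U' = 1 := by rw [hU, hU', ← map_mul, mul_inv_cancel₀ u.ne_zero, map_one]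
  have hψA : ψ ∈ A := ⟨X, aeval_X _⟩
  have hsum : x + y = (U + U') * ψ := by
    apply mul_left_cancel₀ hκw
    rw [h1, map_mul, map_add, mul_assoc]
  have hsumA : x + y ∈ A := by
    rw [hsum]
    exact A.mul_mem (A.add_mem (A.algebraMap_mem _) (A.algebraMap_mem _)) hψA
  have hprodA : x * y ∈ A := by
    have h2 : x * y = κ 2⁻¹ * ((x + y) ^ 2 - κ w₁⁻¹ * (κ w₁ * x ^ 2 + κ w₁ * y ^ 2)) := by
      have h3 : κ w₁⁻¹ * κ w₁ = 1 := by rw [← map_mul, inv_mul_cancel₀ hw₁, map_one]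
      have h4 : κ 2⁻¹ * 2 = 1 := by
        rw [← map_ofNat κ 2, ← map_mul, inv_mul_cancel₀ two_ne_zero, map_one]
      linear_combination κ 2⁻¹ * (x ^ 2 + y ^ 2) * h3 - x * y * h4
    rw [h2]
    exact A.mul_mem (A.algebraMap_mem _) (A.sub_mem (A.pow_mem hsumA 2)
      (A.mul_mem (A.algebraMap_mem _) (h 2)))
  set δ : F := u - (u⁻¹ : F) with hδ
  have hδ0 : δ ≠ 0 := by
    rw [hδ, sub_ne_zero, ← Units.val_inv_eq_inv_val]
    exact fun h => hu (Units.ext h.symm)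
  have hκδ : κ δ = U - U' := map_sub κ _ _
  have hxtop : IsTop x 1 (u * b) := by simpa using hψ.scale u
  set P := x - U' * ψ with hP
  set Q := U * ψ - x with hQ
  have hPtop : IsTop P 1 (δ * b) := by
    convert hxtop.sub (hψ.const_mul (u⁻¹ : F)) using 1
    ring
  have hQtop : IsTop Q (-1) (δ * ψ.coeff 1) := by
    have hco (n : ℤ) : Q.coeff n = (u - ((u ^ (-n) : Fˣ) : F)) * ψ.coeff n := by
      rw [hQ, hU, hκ, ← Algebra.smul_def, HahnSeries.coeff_sub, HahnSeries.coeff_smul, hx,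
        coeff_scale, smul_eq_mul, sub_mul]
    refine ⟨fun i hi => ?_, ?_⟩
    · rw [hco]
      rcases lt_trichotomy i 1 with h | rfl | h
      · obtain rfl : i = 0 := by omega
        rw [neg_zero, hψ0, mul_zero]
      · simp
      · rw [hψ.1 i h, mul_zero]
    · rw [hco]
      simp [hδ]
  have hPQ : P * Q = x * y - ψ ^ 2 := by
    linear_combination (-x) * hsum - ψ ^ 2 * hUU
  set β := b * ψ.coeff 1 with hβ
  have hPQconst : P * Q = κ (δ ^ 2 * β) := by
    have h2 : P * Q ∈ A := by
      rw [hPQ]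
      exact A.sub_mem hprodA (A.pow_mem hψA 2)
    have h3 : IsTop (P * Q) 0 (δ ^ 2 * β) := by
      convert hPtop.mul hQtop using 1
      · norm_num
      · rw [hβ]
        ring
    obtain ⟨q, hq, hq'⟩ := exists_natDegree_le_of_mem_range hψ hb (n := 0) h3 h2
    rw [eq_C_of_natDegree_le_zero hq, aeval_C] at hq'
    rw [← hq'] at h3 ⊢
    rw [(IsTop.algebraMap (q.coeff 0)).eq_of h3]
  have hsq : (x - y) ^ 2 = κ δ ^ 2 * (ψ ^ 2 - κ (4 * β)) := by
    rw [hPQ, map_mul, map_pow] at hPQconst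
    rw [map_mul, map_ofNat]
    rw [hκδ] at hPQconst ⊢
    linear_combination (x + y + (U + U') * ψ) * hsum - 4 * hPQconst + (4 * ψ ^ 2) * hUU
  have hscaley : scale u y = ψ := by rw [hy, scale_scale, mul_inv_cancel, scale_one]
  have hscalex : scale u x = (U + U') * x - ψ := by
    have h2 := congrArg (scale u) hsum
    rw [map_add, hscaley, map_mul, map_add, hU, hU', hκ, AlgHom.commutes, AlgHom.commutes] at h2
    linear_combination h2
  have hscaleP : scale u P = κ (u : F) * P := by
    rw [hP, map_sub, map_mul, hscalex, hU', hκ, AlgHom.commutes]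
    linear_combination ψ * hUU
  have hscaleQ : scale u Q = κ ((u⁻¹ : Fˣ) : F) * Q := by
    rw [Units.val_inv_eq_inv_val, hQ, map_sub, map_mul, hscalex, hU, hκ, AlgHom.commutes]
    linear_combination (-ψ) * hUU
  have hδψ : κ δ * ψ = P + Q := by
    rw [hκδ]
    ring
  set δ' : F := ((u ^ d : Fˣ) : F) - (((u⁻¹) ^ d : Fˣ) : F) with hδ'
  have hδ'0 : δ' ≠ 0 := by
    rw [hδ', sub_ne_zero]
    intro h2
    have h3 : (u ^ d) = (u⁻¹) ^ d := Units.ext h2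
    obtain ⟨m, rfl⟩ := Nat.exists_eq_add_of_le' hm
    apply hu
    calc u⁻¹ = (u ^ d ^ (m + 1))⁻¹ := by rw [hum]
      _ = u ^ d ^ (m + 1) := by rw [← inv_pow, pow_succ', pow_mul, pow_mul, h3]
      _ = u := hum
  have hκδ' : κ δ' = κ ((u ^ d : Fˣ) : F) - κ (((u ^ d)⁻¹ : Fˣ) : F) := by
    rw [hδ', map_sub, inv_pow]
  clear_value δ δ'
  have hP' : scale (u ^ d) P = κ ((u ^ d : Fˣ) : F) * P := by
    rw [Units.val_pow_eq_pow_val]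
    exact scale_pow_eq hscaleP d
  have hQ' : scale (u ^ d) Q = κ ((u⁻¹ ^ d : Fˣ) : F) * Q := by
    rw [Units.val_pow_eq_pow_val]
    exact scale_pow_eq hscaleQ d
  have hPi := scale_inv_eq hP'
  have hQi := scale_inv_eq hQ'
  have hdiff : κ δ * (scale (u ^ d) ψ - scale (u ^ d)⁻¹ ψ) = κ δ' * (x - y) := by
    have h2 := congrArg (scale (u ^ d)) hδψ
    have h3 := congrArg (scale (u ^ d)⁻¹) hδψ
    rw [map_mul, AlgHom.commutes, map_add, hP', hQ'] at h2
    rw [map_mul, AlgHom.commutes, map_add, hPi, hQi, inv_pow, inv_inv] at h3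
    rw [hκδ']
    rw [inv_pow] at h2
    simp only [← hκ] at h2 h3
    rw [hP, hQ] at h2 h3
    linear_combination h2 - h3 + (κ ((u ^ d : Fˣ) : F) - κ (((u ^ d)⁻¹ : Fˣ) : F)) * hsum
  have hfx : aeval x f = expand d hd (scale (u ^ d) ψ) := by
    rw [hx, aeval_algHom_apply, hf, scale_expand]
  have hfy : aeval y f = expand d hd (scale (u ^ d)⁻¹ ψ) := by
    rw [hy, aeval_algHom_apply, hf, scale_expand, inv_pow]
  obtain ⟨R, ⟨r, hr⟩, hR⟩ := exists_pow_sub_pow_eq A hsumA hprodA f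
  change aeval ψ r = R at hr
  have hV := congrArg (expand d hd) hdiff
  rw [map_mul, AlgHom.commutes, map_mul, AlgHom.commutes, map_sub, ← hfx, ← hfy, hR] at hV
  have hVsq := congrArg (expand d hd) hsq
  rw [map_pow, map_mul, map_pow, AlgHom.commutes, map_sub _ (ψ ^ 2), map_pow _ ψ,
    ← hf, AlgHom.commutes] at hVsq
  refine ⟨β, mul_ne_zero hb hγ, C (δ / δ') * r, ?_⟩
  apply aeval_injective_of_isTop hψ one_pos hb
  generalize 4 * β = c at hsq hVsq ⊢
  simp only [map_sub, map_pow, map_mul, aeval_C, aeval_X, hr]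
  change _ - κ c = (κ (δ / δ') * R) ^ 2 * (ψ ^ 2 - κ c)
  have hκδ0 : κ δ ≠ 0 := (map_ne_zero κ).2 hδ0
  have hκδ'0 : κ δ' ≠ 0 := (map_ne_zero κ).2 hδ'0
  rw [map_div₀]
  field_simp
  apply mul_left_cancel₀ (pow_ne_zero 2 hκδ0)
  change κ δ * _ = κ δ' * _ at hV
  change _ = κ δ ^ 2 * (_ - κ c) at hVsq
  linear_combination (-κ δ' ^ 2) * hVsq - (κ δ * ((x - y) * R) + κ δ' * expand d hd (x - y)) * hV
    + κ δ ^ 2 * R ^ 2 * hsq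

end LaurentOps

namespace ChebyshevPell

variable {F : Type} [Field F]

theorem exists_eval_eq_pow_mul_eval_add_inv (q : F[X]) {n : ℕ} (hn : q.natDegree ≤ n) :
    ∃ G : F[X], (∀ x, x ≠ 0 → G.eval x = x ^ n * q.eval (x + x⁻¹)) ∧ G.eval 0 = q.coeff n := by
  refine ⟨∑ k ∈ Finset.range (n + 1), C (q.coeff k) * (X ^ (n - k) * (X ^ 2 + 1) ^ k), ?_, ?_⟩
  · intro x hx
    rw [eval_eq_sum_range' (Nat.lt_succ_of_le hn), eval_finsetSum, Finset.mul_sum]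
    refine Finset.sum_congr rfl fun k hk => ?_
    have hk' : k ≤ n := Nat.lt_succ_iff.1 (Finset.mem_range.1 hk)
    simp only [eval_mul, eval_C, eval_pow, eval_X, eval_add, eval_one]
    have h : x ^ 2 + 1 = x * (x + x⁻¹) := by field_simp
    rw [h, mul_pow, ← mul_assoc (x ^ (n - k)), ← pow_add, Nat.sub_add_cancel hk']
    ring
  · rw [eval_finsetSum, Finset.sum_eq_single_of_mem n (by simp)]
    · simp
    · intro k hk hkn
      have hk' : n - k ≠ 0 := by
        have := Finset.mem_range.1 hk
        omega
      simp [hk']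

theorem natDegree_of_sq_sub_eq {g s : F[X]} (hg : 1 ≤ g.natDegree) {a b : F}
    (h : g ^ 2 - C a = s ^ 2 * (X ^ 2 - C b)) : s.natDegree + 1 = g.natDegree := by
  have h1 := congrArg natDegree h
  have hX : (X ^ 2 - C b : F[X]).natDegree = 2 := natDegree_X_pow_sub_C
  have h2 : (g ^ 2 - C a).natDegree = 2 * g.natDegree := by
    rw [natDegree_sub_C, natDegree_pow]
  have hs : s ≠ 0 := by
    rintro rfl
    rw [h2] at h1
    simp at h1
    omega
  rw [h2, natDegree_mul (pow_ne_zero 2 hs) (ne_zero_of_natDegree_gt (n := 0) (by omega)),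
    natDegree_pow, hX] at h1
  omega

theorem isChebyshevPoly_of_eval_eq [CharZero F] {g : F[X]} {d : ℕ} (hd : 1 ≤ d) {a b : F}
    (hab : a * b = 4)
    (h : ∀ x : F, x ≠ 0 → a + b * x ^ (2 * d) = 2 * (x ^ d * g.eval (x + x⁻¹))) :
    IsChebyshevPoly d g ∨ IsChebyshevPoly d (-g) := by
  have h2 : (2 : F) ≠ 0 := two_ne_zero
  have hpal : a = b := by
    have e1 := h 2 h2
    have e2 := h 2⁻¹ (inv_ne_zero h2)
    rw [inv_inv, add_comm (2⁻¹ : F), inv_pow, inv_pow] at e2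
    have e3 : (a - b) * ((2 : F) ^ (2 * d) - 1) = 0 := by
      have h4 : (2 : F) ^ (2 * d) = 2 ^ d * 2 ^ d := by rw [two_mul, pow_add]
      have h5 : (2 : F) ^ d ≠ 0 := pow_ne_zero d h2
      rw [h4] at e1 e2 ⊢
      generalize eval ((2 : F) + 2⁻¹) g = y at e1 e2
      field_simp at e2
      linear_combination e2 - e1
    have h6 : (2 : F) ^ (2 * d) - 1 ≠ 0 := by
      rw [sub_ne_zero]
      have : 2 ^ (2 * d) ≠ 1 := (Nat.one_lt_two_pow (by omega)).ne'
      exact_mod_cast this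
    exact sub_eq_zero.1 ((mul_eq_zero.1 e3).resolve_right h6)
  subst hpal
  have hfac : (a - 2) * (a + 2) = 0 := by linear_combination hab
  have key (x : F) (hx : x ≠ 0) : 2 * g.eval (x + x⁻¹) = a * (x ^ d + x⁻¹ ^ d) := by
    have hxd : x ^ d ≠ 0 := pow_ne_zero d hx
    have h4 := h x hx
    rw [two_mul d, pow_add] at h4
    rw [inv_pow]
    generalize eval (x + x⁻¹) g = y at h4 ⊢
    field_simp
    linear_combination -h4
  rcases mul_eq_zero.1 hfac with ha | ha
  · left
    intro x hx
    apply mul_left_cancel₀ h2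
    rw [key x hx, sub_eq_zero.1 ha]
  · right
    intro x hx
    apply mul_left_cancel₀ h2
    rw [eval_neg]
    linear_combination -key x hx - (x ^ d + x⁻¹ ^ d) * ha

theorem isChebyshevPoly_of_sq_sub_four_eq [CharZero F] {g s : F[X]} (hg : 1 ≤ g.natDegree)
    (h : g ^ 2 - C 4 = s ^ 2 * (X ^ 2 - C 4)) :
    IsChebyshevPoly g.natDegree g ∨ IsChebyshevPoly g.natDegree (-g) := by
  have hdeg := natDegree_of_sq_sub_eq hg h
  set d := g.natDegree with hd
  obtain ⟨G, hG, hG0⟩ := exists_eval_eq_pow_mul_eval_add_inv g le_rfl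
  obtain ⟨S, hS, -⟩ := exists_eval_eq_pow_mul_eval_add_inv s le_rfl
  set H := S * (X ^ 2 - 1) with hH
  have hGH : (G - H) * (G + H) = C 4 * X ^ (2 * d) := by
    apply mul_left_cancel₀ X_ne_zero
    refine Polynomial.funext fun x => ?_
    by_cases hx : x = 0
    · simp [hx]
    have h1 := congrArg (eval (x + x⁻¹)) h
    simp only [eval_sub, eval_pow, eval_mul, eval_C, eval_X] at h1
    simp only [eval_sub, eval_pow, eval_mul, eval_C, eval_X, eval_add, eval_one, hH, hG x hx,
      hS x hx]
    have h2 : x ^ s.natDegree * (x ^ 2 - 1) = x ^ d * (x - x⁻¹) := by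
      rw [← hdeg, pow_succ]
      field_simp
      ring
    have h3 : (x + x⁻¹) ^ 2 - 4 = (x - x⁻¹) ^ 2 := by
      field_simp
      ring
    rw [h3] at h1
    rw [← hd, mul_comm 2 d, pow_mul]
    linear_combination x * (x ^ d) ^ 2 * h1 - x * eval (x + x⁻¹) s ^ 2 *
      (x ^ s.natDegree * (x ^ 2 - 1) + x ^ d * (x - x⁻¹)) * h2
  have h4 : (4 : F) ≠ 0 := OfNat.ofNat_ne_zero 4
  have hdvd : G - H ∣ X ^ (2 * d) := by
    refine ⟨C 4⁻¹ * (G + H), ?_⟩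
    rw [mul_left_comm, hGH, ← mul_assoc, ← C_mul, inv_mul_cancel₀ h4, C_1, one_mul]
  obtain ⟨i, hi, hassoc⟩ := (dvd_prime_pow prime_X _).1 hdvd
  obtain ⟨v, hv⟩ := hassoc.symm
  obtain ⟨c, hc, hcv⟩ := Polynomial.isUnit_iff.1 v.isUnit
  have hc0 : c ≠ 0 := hc.ne_zero
  rw [← hcv] at hv
  have hsum : G + H = C (4 / c) * X ^ (2 * d - i) := by
    apply mul_left_cancel₀ (a := X ^ i * C c) (mul_ne_zero (pow_ne_zero i X_ne_zero)
      (C_ne_zero.2 hc0))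
    have h5 : (X : F[X]) ^ (2 * d) = X ^ i * X ^ (2 * d - i) := by
      rw [← pow_add, Nat.add_sub_cancel' hi]
    have h6 : (C 4 : F[X]) = C c * C (4 / c) := by rw [← C_mul, mul_div_cancel₀ _ hc0]
    rw [hv, hGH, h5, ← hv, h6]
    ring
  have h2G : C 2 * G = X ^ i * C c + C (4 / c) * X ^ (2 * d - i) := by
    rw [hv, ← hsum, map_ofNat]
    ring
  have hval (x : F) (hx : x ≠ 0) :
      x ^ i * c + 4 / c * x ^ (2 * d - i) = 2 * (x ^ d * g.eval (x + x⁻¹)) := by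
    rw [← hG x hx]
    have h7 := congrArg (eval x) h2G
    simp only [eval_mul, eval_C, eval_add, eval_pow, eval_X] at h7
    exact h7.symm
  have hends : i = 0 ∨ i = 2 * d := by
    by_contra! hcon
    have h7 := congrArg (eval 0) h2G
    have h8 : 2 * d - i ≠ 0 := by omega
    simp only [eval_mul, eval_C, eval_add, eval_pow, eval_X, hG0, zero_pow hcon.1, zero_pow h8,
      zero_mul, mul_zero, add_zero, coeff_natDegree] at h7
    have h9 : g = 0 := leadingCoeff_eq_zero.1 ((mul_eq_zero.1 h7).resolve_left two_ne_zero)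
    rw [hd, h9, natDegree_zero] at hg
    omega
  rcases hends with rfl | rfl
  · refine isChebyshevPoly_of_eval_eq hg (a := c) (b := 4 / c) (mul_div_cancel₀ _ hc0) ?_
    simpa using hval
  · refine isChebyshevPoly_of_eval_eq hg (a := 4 / c) (b := c) (div_mul_cancel₀ _ hc0) ?_
    intro x hx
    have := hval x hx
    rw [Nat.sub_self, pow_zero] at this
    linear_combination this

theorem isSpecialPolyAux_of_sq_sub_eq [IsAlgClosed F] [CharZero F] {f r : F[X]}
    (hf : 1 ≤ f.natDegree) {e β : F} (hβ : β ≠ 0)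
    (h : (f.comp (X + C e) - C e) ^ 2 - C (4 * β) = r ^ 2 * (X ^ 2 - C (4 * β))) :
    IsSpecialPolyAux f := by
  obtain ⟨γ, rfl⟩ := IsAlgClosed.exists_pow_nat_eq β two_pos
  have hγ : γ ≠ 0 := by
    rintro rfl
    simp at hβ
  set g : F[X] := C γ⁻¹ * (f.comp (X + C e) - C e).comp (C γ * X) with hg
  have hdeg : g.natDegree = f.natDegree := by
    rw [hg, natDegree_C_mul (inv_ne_zero hγ), natDegree_comp, natDegree_C_mul_X _ hγ,
      natDegree_sub_C, natDegree_comp, natDegree_X_add_C, mul_one, mul_one]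
  have hcc : (C γ⁻¹ : F[X]) * C γ = 1 := by rw [← C_mul, inv_mul_cancel₀ hγ, C_1]
  have hpell : g ^ 2 - C 4 = (r.comp (C γ * X)) ^ 2 * (X ^ 2 - C 4) := by
    have h1 := congrArg (fun q => q.comp (C γ * X)) h
    simp only [sub_comp, pow_comp, mul_comp, C_comp, X_comp] at h1
    rw [C_mul, C_pow] at h1
    rw [hg, sub_comp, C_comp]
    linear_combination (C γ⁻¹) ^ 2 * h1 + (C γ⁻¹ * C γ + 1) *
      (r.comp (C γ * X) ^ 2 * (X ^ 2 - C 4) + C 4) * hcc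
  refine ⟨γ, e, hγ, g, Or.inr ?_, ?_⟩
  · rw [← hdeg]
    exact isChebyshevPoly_of_sq_sub_four_eq (by omega) hpell
  · have h1 : (f.comp (X + C e)).comp (C γ * X) = f.comp (C γ * X + C e) := by
      rw [comp_assoc, add_comp, X_comp, C_comp]
    rw [hg]
    simp only [add_comp, mul_comp, C_comp, X_comp, sub_comp, h1]
    linear_combination (f.comp (C γ * X + C e) - C e) * hcc

end ChebyshevPell

namespace LaurentOps

variable {F : Type} [Field F]

theorem exists_pow_mul_self_modEq (D T B : ℕ) (hD : 2 ≤ D) (hT : 0 < T) :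
    ∃ s, 1 ≤ s ∧ B < D ^ s ∧ D ^ s * D ^ s ≡ D ^ s [MOD T] := by
  have : NeZero T := ⟨hT.ne'⟩
  obtain ⟨a, b, hab, h⟩ :=
    Finite.exists_ne_map_eq_of_infinite fun k : ℕ => (D : ZMod T) ^ k
  wlog hlt : a < b generalizing a b
  · exact this b a hab.symm h.symm (by omega)
  obtain ⟨q, rfl⟩ := Nat.exists_eq_add_of_lt hlt
  have hper (j k : ℕ) : (D : ZMod T) ^ (a + k + j * (q + 1)) = (D : ZMod T) ^ (a + k) := by
    induction j with
    | zero => simp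
    | succ j ih =>
      calc (D : ZMod T) ^ (a + k + (j + 1) * (q + 1))
          = D ^ (a + q + 1) * D ^ (k + j * (q + 1)) := by rw [← pow_add]; congr 1; ring
        _ = D ^ (a + k + j * (q + 1)) := by rw [← h, ← pow_add, add_assoc]
        _ = _ := ih
  set s := (a + 1 + B) * (q + 1) with hs
  have hsge : a + 1 + B ≤ s := Nat.le_mul_of_pos_right _ (by omega)
  refine ⟨s, by omega, (Nat.lt_pow_self (by omega)).trans_le' (by omega), ?_⟩
  rw [← ZMod.natCast_eq_natCast_iff]
  push_cast
  rw [← pow_add]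
  have h2 := hper (a + 1 + B) (s - a)
  rwa [Nat.add_sub_cancel' (by omega : a ≤ s)] at h2

/-- If `ζ ψ = ψ(ζ t)` and `g(ψ) = ψ(c t ^ e)` then `ζ` is an `e`-th power of such a scalar,
unless `f` satisfies a Pell equation. -/
theorem exists_pow_eq_of_scale_eq [IsAlgClosed F] [CharZero F] {ψ : LaurentSeries F} {b : F}
    (hb : b ≠ 0) (hψ : IsTop ψ 1 b) (hψ0 : ψ.coeff 0 = 0) (hne : ψ ≠ HahnSeries.single (-1) b)
    {f : F[X]} {d : ℕ} (hfd : f.natDegree = d) (hd : 2 ≤ d)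
    (hf : aeval ψ f = expand d (by omega) ψ)
    (hpell : ∀ β : F, β ≠ 0 → ∀ r : F[X], f ^ 2 - C (4 * β) ≠ r ^ 2 * (X ^ 2 - C (4 * β)))
    {g : F[X]} (hg : 0 < g.natDegree) {c : Fˣ}
    (hgψ : aeval ψ g = expand g.natDegree hg (scale c ψ)) {ζ : Fˣ} {m₀ : ℕ} (hm₀ : 1 ≤ m₀)
    (hζ : ζ ^ d ^ m₀ = ζ) (hζψ : scale ζ ψ = algebraMap F _ (ζ : F) * ψ) :
    ∃ α : Fˣ, (∃ m, 1 ≤ m ∧ α ^ d ^ m = α) ∧ scale α ψ = algebraMap F _ (α : F) * ψ ∧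
      α ^ g.natDegree = ζ := by
  set e := g.natDegree with he
  obtain ⟨r, hr, γ, hγ, htop⟩ := exists_isTop_sub_single hψ hψ0 hne
  have hD : 2 ≤ d ^ m₀ := hd.trans (Nat.le_self_pow (by omega) d)
  set n := d ^ m₀ - 1 with hn
  have hζn : ζ ^ n = 1 := by
    have h1 : ζ ^ n * ζ = 1 * ζ := by
      rw [← pow_succ, hn, Nat.sub_add_cancel (by omega), hζ, one_mul]
    exact mul_right_cancel h1
  obtain ⟨s, hs, hrs, hidem⟩ := exists_pow_mul_self_modEq (d ^ m₀) (e * n) (r + 1) hD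
    (Nat.mul_pos hg (by omega))
  rw [← pow_mul] at hrs hidem
  have hζN : ζ ^ d ^ (m₀ * s) = ζ := by
    rw [pow_mul]
    clear hrs hidem hs
    induction s with
    | zero => simp
    | succ s ih => rw [pow_succ, pow_mul, ih, hζ]
  obtain ⟨z, hz⟩ := IsAlgClosed.exists_pow_nat_eq (ζ : F) hg
  have hz0 : z ≠ 0 := by
    rintro rfl
    rw [zero_pow hg.ne'] at hz
    exact ζ.ne_zero hz.symm
  set ω₀ : Fˣ := Units.mk0 z hz0 with hω₀
  have hω₀e : ω₀ ^ e = ζ := Units.ext hz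
  obtain ⟨μ, hμ⟩ := exists_units_isPrimitiveRoot (F := F) e hg
  set ω : Fin e → Fˣ := fun i => ω₀ * μ ^ (i : ℕ) with hω
  have hωe (i : Fin e) : ω i ^ e = ζ := by
    rw [hω, mul_pow, hω₀e, ← pow_mul, mul_comm (i : ℕ), pow_mul, hμ.pow_eq_one, one_pow, mul_one]
  have hωsurj (v : Fˣ) (hv : v ^ e = ζ) : ∃ i, ω i = v := by
    have : NeZero e := ⟨hg.ne'⟩
    have h1 : ((ω₀⁻¹ * v : Fˣ) : F) ^ e = 1 := by
      rw [← Units.val_pow_eq_pow_val, mul_pow, inv_pow, hω₀e, hv, inv_mul_cancel, Units.val_one]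
    obtain ⟨i, hi, h⟩ := (IsPrimitiveRoot.coe_units_iff.2 hμ).eq_pow_of_pow_eq_one h1
    have h2 : μ ^ i = ω₀⁻¹ * v := Units.ext (by rw [Units.val_pow_eq_pow_val, h])
    exact ⟨⟨i, hi⟩, by simp only [hω, h2, mul_inv_cancel_left]⟩
  choose σ hσ using fun i => hωsurj (ω i ^ d ^ (m₀ * s))
    (by rw [← pow_mul, mul_comm, pow_mul, hωe, hζN])
  have hωinj : Function.Injective ω := by
    intro i j h
    exact Fin.ext (hμ.pow_inj i.2 j.2 (mul_left_cancel h))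
  let D : Frame F (Fin e) :=
    { ψ := ψ
      b := b
      b_ne_zero := hb
      isTop := hψ
      N := d ^ (m₀ * s)
      N_pos := Nat.pow_pos (by omega)
      p := polIter f (m₀ * s)
      natDegree_p := by rw [natDegree_polIter, hfd]
      aeval_p := aeval_polIter (by omega) hf _
      g := g
      ζ := ζ
      ω := ω
      ω_injective := hωinj
      g_pos := hg
      natDegree_g := by simp [he]
      aeval_g := fun i => by
        rw [aeval_algHom_apply, hgψ, scale_expand, hωe, scale_scale, mul_comm ζ, ← scale_scale, hζψ,
          map_mul, map_mul, AlgHom.commutes, AlgHom.commutes]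
      σ := σ
      ω_σ := hσ
      σ_σ := fun i => by
        apply hωinj
        rw [hσ, hσ, ← pow_mul]
        refine pow_eq_pow_of_modEq hidem ?_
        rw [pow_mul, hωe, hζn] }
  have : Nonempty (Fin e) := ⟨⟨0, hg⟩⟩
  obtain ⟨i, hi, h⟩ := D.exists_linear_or_pair hψ0 hr hγ htop hrs
  have hfix : ω i ^ d ^ (m₀ * s) = ω i := by
    rw [← hσ i]
    exact congrArg ω hi
  have hms : 1 ≤ m₀ * s := Nat.mul_pos hm₀ hs
  rcases h with h | ⟨rfl, hinv, w₁, w₂, hw₁, hw⟩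
  · exact ⟨ω i, ⟨_, hms, hfix⟩, h, hωe i⟩
  · exfalso
    have hγ1 : ψ.coeff 1 ≠ 0 := by
      have h1 := htop.2
      rw [HahnSeries.coeff_sub, HahnSeries.coeff_single_of_ne (by norm_num)] at h1
      simp only [Nat.cast_one, neg_neg, sub_zero] at h1
      rwa [h1]
    obtain ⟨β, hβ, r, hr⟩ := exists_sq_sub_eq hb hψ hψ0 hγ1 (by omega) hf hinv hms hfix hw₁ hw
    exact hpell β hβ r hr

/-- The linear polynomial with fixed point `e` and multiplier `c`. -/
noncomputable def homothety (e c : F) : F[X] := C c * X + C ((1 - c) * e)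

theorem homothety_one (e : F) : homothety e 1 = X := by simp [homothety]

theorem homothety_comp (e c c' : F) :
    (homothety e c).comp (homothety e c') = homothety e (c * c') := by
  simp only [homothety, add_comp, mul_comp, C_comp, X_comp, sub_comp, one_comp, map_mul, map_sub,
    map_one]
  ring

theorem polIter_homothety (e c : F) (k : ℕ) : polIter (homothety e c) k = homothety e (c ^ k) := by
  induction k with
  | zero => rw [polIter, pow_zero, homothety_one]
  | succ k ih => rw [polIter, ih, homothety_comp, pow_succ']

theorem homothety_injective (e : F) : Function.Injective (homothety e) := by
  intro c c' h
  simpa [homothety] using congrArg (fun q => q.coeff 1) h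

theorem natDegree_homothety (e : F) {c : F} (hc : c ≠ 0) : (homothety e c).natDegree = 1 :=
  natDegree_linear hc

/-- The scalars `a`, fixed by a power of the `d`-th power map, with `ψ(a t) = a ψ(t)`. -/
def scalarSymmetries (d : ℕ) (ψ : LaurentSeries F) : Subgroup Fˣ where
  carrier := {a | (∃ m, 1 ≤ m ∧ a ^ d ^ m = a) ∧ scale a ψ = algebraMap F _ (a : F) * ψ}
  one_mem' := ⟨⟨1, le_rfl, one_pow _⟩, by simp [scale_one]⟩
  mul_mem' := by
    rintro u v ⟨⟨m, hm, hu⟩, hu'⟩ ⟨⟨n, hn, hv⟩, hv'⟩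
    have key {w : Fˣ} {j : ℕ} (h : w ^ d ^ j = w) (i : ℕ) : w ^ d ^ (j * i) = w := by
      induction i with
      | zero => simp
      | succ i ih => rw [mul_add_one, pow_add, pow_mul, ih, h]
    refine ⟨⟨m * n, Nat.mul_pos hm hn, ?_⟩, ?_⟩
    · rw [mul_pow, key hu n, mul_comm m, key hv m]
    · rw [← scale_scale, hv', map_mul, AlgHom.commutes, hu', ← mul_assoc, ← map_mul, Units.val_mul,
        mul_comm (v : F)]
  inv_mem' := by
    rintro u ⟨⟨m, hm, hu⟩, hu'⟩
    exact ⟨⟨m, hm, by rw [inv_pow, hu]⟩, scale_inv_eq hu'⟩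

theorem finite_scalarSymmetries (d : ℕ) {ψ : LaurentSeries F} {r : ℕ} (hr : ψ.coeff r ≠ 0) :
    Finite (scalarSymmetries d ψ) := by
  have : NeZero (r + 1) := ⟨r.succ_ne_zero⟩
  refine Set.Finite.subset (s := (rootsOfUnity (r + 1) F : Set Fˣ))
    (inferInstanceAs (Finite (rootsOfUnity (r + 1) F))) ?_
  rintro a ⟨-, ha⟩
  have h1 := congrArg (fun q => q.coeff (r : ℤ)) ha
  simp only [coeff_scale, ← Algebra.smul_def, HahnSeries.coeff_smul, smul_eq_mul] at h1
  have h2 : a ^ (-(r : ℤ)) = a := Units.ext (mul_right_cancel₀ hr h1)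
  rw [zpow_neg, zpow_natCast, inv_eq_iff_mul_eq_one] at h2
  rw [SetLike.mem_coe, mem_rootsOfUnity, pow_succ, h2]

theorem expand_one (h : 0 < 1) (a : LaurentSeries F) : expand 1 h a = a := by
  ext n
  simpa using coeff_expand_mul 1 h a n

theorem aeval_sub_algebraMap (q : F[X]) (ψ : LaurentSeries F) (e : F) :
    aeval (ψ - algebraMap F _ e) (q.comp (X + C e) - C e) = aeval ψ q - algebraMap F _ e := by
  rw [map_sub, aeval_comp, map_add, aeval_X, aeval_C, sub_add_cancel]

theorem scale_eq_of_mem_scalarSymmetries {d : ℕ} {ψ : LaurentSeries F} {e : F} {a : Fˣ}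
    (ha : a ∈ scalarSymmetries d (ψ - algebraMap F _ e)) :
    aeval ψ (homothety e (a : F)) = scale a ψ := by
  have h := ha.2
  rw [map_sub, AlgHom.commutes, sub_eq_iff_eq_add] at h
  rw [h, homothety, map_add, map_mul, aeval_C, aeval_X, aeval_C, map_mul, map_sub, map_one]
  ring

theorem linCommSet_eq_image [CharZero F] {f : F[X]} {d : ℕ} (hfd : f.natDegree = d) (hd : 2 ≤ d)
    {ψ : LaurentSeries F} {b : F} (hb : b ≠ 0) (hψ : IsTop ψ 1 b)
    (hf : aeval ψ f = expand d (by omega) ψ) :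
    linCommSet f = (fun a : Fˣ => homothety (ψ.coeff 0) (a : F)) ''
      scalarSymmetries d (ψ - algebraMap F _ (ψ.coeff 0)) := by
  ext L
  constructor
  · rintro ⟨hL, m, hm, hcomm⟩
    obtain ⟨c, hc, hLψ, hcb⟩ := aeval_of_commutesWithIterate hfd hd hb hψ hf hm hcomm
      (by rw [hL]; exact one_pos)
    have hlc : (c : F) = L.coeff 1 := by
      rw [hL, pow_one, leadingCoeff, hL] at hcb
      exact mul_right_cancel₀ hb hcb
    rw [expand_congr hL _ one_pos, expand_one] at hLψ
    have hLeq := eq_X_add_C_of_natDegree_le_one hL.le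
    rw [← hlc] at hLeq
    rw [hLeq, map_add, map_mul, aeval_C, aeval_C, aeval_X] at hLψ
    have h0 := congrArg (fun q => q.coeff 0) hLψ
    simp only [HahnSeries.coeff_add, ← Algebra.smul_def, HahnSeries.coeff_smul, smul_eq_mul,
      coeff_algebraMap_zero, coeff_scale, neg_zero, zpow_zero, Units.val_one, one_mul] at h0
    have h1 : L.coeff 0 = (1 - c) * ψ.coeff 0 := by linear_combination h0
    refine ⟨c, ⟨⟨m, hm, hc⟩, ?_⟩, ?_⟩
    · rw [map_sub, AlgHom.commutes, ← hLψ, h1, map_mul, map_sub, map_one]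
      ring
    · simp only [homothety]
      rw [hLeq, h1]
  · rintro ⟨a, ha, rfl⟩
    obtain ⟨m, hm, ham⟩ := ha.1
    refine ⟨natDegree_homothety _ a.ne_zero, m, hm, ?_⟩
    apply aeval_injective_of_isTop hψ one_pos hb
    have h1 := aeval_polIter (by omega) hf m
    rw [aeval_comp, aeval_comp, h1, scale_eq_of_mem_scalarSymmetries ha, aeval_algHom_apply,
      aeval_algHom_apply, h1, scale_expand, ham, scale_eq_of_mem_scalarSymmetries ha]

theorem comp_homothety_eq {d : ℕ} {ψ : LaurentSeries F} {b : F} (hb : b ≠ 0) (hψ : IsTop ψ 1 b)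
    {g : F[X]} (hg : 0 < g.natDegree) {c : Fˣ}
    (hgψ : aeval ψ g = expand g.natDegree hg (scale c ψ)) {e : F} {a : Fˣ}
    (ha : a ∈ scalarSymmetries d (ψ - algebraMap F _ e)) :
    g.comp (homothety e (a : F)) = (homothety e ((a : F) ^ g.natDegree)).comp g := by
  apply aeval_injective_of_isTop hψ one_pos hb
  have ha' := scale_eq_of_mem_scalarSymmetries (Subgroup.pow_mem _ ha g.natDegree)
  rw [Units.val_pow_eq_pow_val] at ha'
  rw [aeval_comp, aeval_comp, scale_eq_of_mem_scalarSymmetries ha, aeval_algHom_apply, hgψ,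
    aeval_algHom_apply, aeval_algHom_apply, ha', scale_expand, scale_scale, scale_scale, mul_comm]

theorem isSpecialPolyAux_of_aeval_single [CharZero F] {f : F[X]} {d : ℕ} (hfd : f.natDegree = d)
    (hd : 0 < d) {b e : F} (hb : b ≠ 0)
    (hf : aeval (HahnSeries.single (-1) b : LaurentSeries F) (f.comp (X + C e) - C e) =
      expand d hd (HahnSeries.single (-1) b)) : IsSpecialPolyAux f := by
  have htop : IsTop (HahnSeries.single (-1) b : LaurentSeries F) 1 b :=
    ⟨fun i hi => HahnSeries.coeff_single_of_ne (by omega), HahnSeries.coeff_single_same _ _⟩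
  have hexp : expand d hd (HahnSeries.single (-1) b : LaurentSeries F) =
      HahnSeries.single (-(d : ℤ)) b := by
    ext n
    by_cases hn : (d : ℤ) ∣ n
    · obtain ⟨n, rfl⟩ := hn
      rw [coeff_expand_mul]
      by_cases h : n = -1
      · subst h
        simp
      · have h' : (d : ℤ) * n ≠ -d := by
          intro h2
          apply h
          have : (d : ℤ) ≠ 0 := by omega
          exact mul_left_cancel₀ this (by linarith)
        rw [HahnSeries.coeff_single_of_ne h, HahnSeries.coeff_single_of_ne h']
    · rw [coeff_expand_of_not_dvd _ _ _ _ hn, HahnSeries.coeff_single_of_ne]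
      rintro rfl
      exact hn (by simp)
  have hfeq : f.comp (X + C e) - C e = C (b / b ^ d) * X ^ d := by
    apply aeval_injective_of_isTop htop one_pos hb
    rw [hf, hexp, map_mul, map_pow, aeval_C, aeval_X, HahnSeries.single_pow, ← Algebra.smul_def]
    ext n
    have hbd : b / b ^ d * b ^ d = b := div_mul_cancel₀ _ (pow_ne_zero d hb)
    rw [HahnSeries.coeff_smul]
    simp only [HahnSeries.coeff_single, smul_neg, nsmul_eq_mul, mul_one, smul_eq_mul]
    split_ifs <;> simp [hbd]
  refine ⟨b, e, hb, X ^ d, Or.inl (by rw [hfd]), ?_⟩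
  have h1 : f.comp (C b * X + C e) = (f.comp (X + C e) - C e).comp (C b * X) + C e := by
    rw [sub_comp, comp_assoc, add_comp, X_comp, C_comp, sub_add_cancel]
  rw [h1, hfeq]
  simp only [add_comp, mul_comp, C_comp, X_comp, pow_comp, mul_pow]
  rw [← mul_assoc, ← C_pow, ← C_mul, div_mul_cancel₀ _ (pow_ne_zero d hb)]

end LaurentOps

/-- **The group `M(f^∞)` is finite cyclic, and the semiconjugacy `f̃∘L = L^D∘f̃`**
(Proposition 2.3(b),(c)).

Let `F` be an algebraically closed field of characteristic 0 and `f ∈ F[X]` a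
disintegrated polynomial of degree `d ≥ 2`. Then `M(f^∞)`, the set of linear polynomials
commuting with some iterate of `f`, is a finite cyclic group under composition; and if
`f̃` is a polynomial of lowest degree among the polynomials of degree at least 2 commuting
with some iterate of `f`, then there is `D > 0` coprime to the order of `M(f^∞)` with
`f̃ ∘ L = L^D ∘ f̃` for every `L ∈ M(f^∞)`. -/
theorem linear_commuting_group_finite_cyclic
    (F : Type) [Field F] [IsAlgClosed F] [CharZero F]
    (d : ℕ) (hd : 2 ≤ d)
    (f : Polynomial F) (hfd : f.natDegree = d) (hdis : IsDisintegratedAux f)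
    (ft : Polynomial F) (hft2 : 2 ≤ ft.natDegree)
    (hftcomm : CommutesWithIterate f ft)
    (hftmin : ∀ g : Polynomial F, 2 ≤ g.natDegree → CommutesWithIterate f g →
      ft.natDegree ≤ g.natDegree) :
    (linCommSet f).Finite ∧
      (X : Polynomial F) ∈ linCommSet f ∧
      (∀ L₁ ∈ linCommSet f, ∀ L₂ ∈ linCommSet f, L₁.comp L₂ ∈ linCommSet f) ∧
      (∀ L ∈ linCommSet f, ∃ L' ∈ linCommSet f,
        L.comp L' = (X : Polynomial F) ∧ L'.comp L = (X : Polynomial F)) ∧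
      (∃ L₀ ∈ linCommSet f, ∀ L ∈ linCommSet f, ∃ k : ℕ, polIter L₀ k = L) ∧
      ∃ D : ℕ, 0 < D ∧ Nat.Coprime D (linCommSet f).ncard ∧
        ∀ L ∈ linCommSet f, ft.comp L = (polIter L D).comp ft := by
  obtain ⟨b, hfb⟩ : ∃ b, f.leadingCoeff * b ^ (d - 1) = 1 := by
    have hlc : f.leadingCoeff ≠ 0 := by
      rw [leadingCoeff_ne_zero]
      rintro rfl
      rw [natDegree_zero] at hfd
      omega
    obtain ⟨b, hb⟩ := IsAlgClosed.exists_pow_nat_eq f.leadingCoeff⁻¹ (show 0 < d - 1 by omega)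
    exact ⟨b, by rw [hb, mul_inv_cancel₀ hlc]⟩
  have hb : b ≠ 0 := by
    rintro rfl
    rw [zero_pow (by omega), mul_zero] at hfb
    exact zero_ne_one hfb
  obtain ⟨ψ, hψ, hfψ⟩ := LaurentOps.exists_boettcher f d hfd hd b hfb
  set e := ψ.coeff 0 with he
  set ψ₀ := ψ - algebraMap F (LaurentSeries F) e with hψ₀
  have hψ₀top : LaurentOps.IsTop ψ₀ 1 b := by
    simpa using hψ.sub ((LaurentOps.IsTop.algebraMap e).lower one_pos)
  have hψ₀0 : ψ₀.coeff 0 = 0 := by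
    rw [hψ₀, HahnSeries.coeff_sub, LaurentOps.coeff_algebraMap_zero, sub_self]
  have hcdeg (q : F[X]) : (q.comp (X + C e) - C e).natDegree = q.natDegree := by
    rw [natDegree_sub_C, natDegree_comp, natDegree_X_add_C, mul_one]
  have hfψ₀ : aeval ψ₀ (f.comp (X + C e) - C e) = LaurentOps.expand d (by omega) ψ₀ := by
    rw [LaurentOps.aeval_sub_algebraMap, hfψ, hψ₀, map_sub, AlgHom.commutes]
  have hne : ψ₀ ≠ HahnSeries.single (-1) b := by
    intro h
    rw [h] at hfψ₀
    exact hdis.2 (LaurentOps.isSpecialPolyAux_of_aeval_single hfd _ hb hfψ₀)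
  have hpell (β : F) (hβ : β ≠ 0) (r : F[X]) :
      (f.comp (X + C e) - C e) ^ 2 - C (4 * β) ≠ r ^ 2 * (X ^ 2 - C (4 * β)) := fun h =>
    hdis.2 (ChebyshevPell.isSpecialPolyAux_of_sq_sub_eq (by omega) hβ h)
  obtain ⟨m, hm, hcomm⟩ := hftcomm
  obtain ⟨c, -, hftψ, -⟩ := LaurentOps.aeval_of_commutesWithIterate hfd hd hb hψ hfψ hm hcomm
    (by omega)
  have hg₀ : 0 < (ft.comp (X + C e) - C e).natDegree := by
    rw [hcdeg]
    omega
  have hftψ₀ : aeval ψ₀ (ft.comp (X + C e) - C e) =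
      LaurentOps.expand _ hg₀ (LaurentOps.scale c ψ₀) := by
    rw [LaurentOps.aeval_sub_algebraMap, hftψ, LaurentOps.expand_congr (hcdeg ft) _ (by omega), hψ₀,
      map_sub, map_sub, AlgHom.commutes, AlgHom.commutes]
  set S := LaurentOps.scalarSymmetries d ψ₀ with hS
  have hM := LaurentOps.linCommSet_eq_image hfd hd hb hψ hfψ
  rw [← he, ← hψ₀, ← hS] at hM
  have hfin : Finite S := by
    obtain ⟨r, -, γ, hγ, hr⟩ := LaurentOps.exists_isTop_sub_single hψ₀top hψ₀0 hne
    refine LaurentOps.finite_scalarSymmetries d (r := r) ?_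
    have h := hr.2
    rw [neg_neg, HahnSeries.coeff_sub, HahnSeries.coeff_single_of_ne (by omega), sub_zero] at h
    rwa [h]
  have hcyc : IsCyclic S := isCyclic_subgroup_units S
  obtain ⟨⟨ζ, hζS⟩, hζ⟩ := IsCyclic.exists_monoid_generator (α := S)
  have hgen (a : Fˣ) (ha : a ∈ S) : ∃ k : ℕ, ζ ^ k = a := by
    obtain ⟨k, hk⟩ := hζ ⟨a, ha⟩
    exact ⟨k, congrArg Subtype.val hk⟩
  have hcard : (linCommSet f).ncard = orderOf ζ := by
    have hinj : Function.Injective fun a : Fˣ => LaurentOps.homothety e (a : F) :=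
      (LaurentOps.homothety_injective e).comp Units.val_injective
    rw [hM, Set.ncard_image_of_injective _ hinj, ← Subgroup.orderOf_mk ζ hζS,
      orderOf_eq_card_of_forall_mem_powers hζ]
    rfl
  have hmem {a : Fˣ} (ha : a ∈ S) : LaurentOps.homothety e (a : F) ∈ linCommSet f :=
    hM ▸ Set.mem_image_of_mem _ ha
  have hmem' {L : F[X]} (hL : L ∈ linCommSet f) :
      ∃ a ∈ S, LaurentOps.homothety e ((a : Fˣ) : F) = L := by
    rwa [hM] at hL
  refine ⟨?_, ?_, ?_, ?_, ?_, ft.natDegree, by omega, ?_, ?_⟩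
  · rw [hM]
    exact Set.Finite.image _ hfin
  · rw [← LaurentOps.homothety_one e, ← Units.val_one]
    exact hmem S.one_mem
  · intro L₁ h₁ L₂ h₂
    obtain ⟨a₁, ha₁, rfl⟩ := hmem' h₁
    obtain ⟨a₂, ha₂, rfl⟩ := hmem' h₂
    rw [LaurentOps.homothety_comp, ← Units.val_mul]
    exact hmem (S.mul_mem ha₁ ha₂)
  · intro L h
    obtain ⟨a, ha, rfl⟩ := hmem' h
    refine ⟨_, hmem (S.inv_mem ha), ?_, ?_⟩ <;>
      rw [LaurentOps.homothety_comp, ← Units.val_mul] <;> simp [LaurentOps.homothety_one]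
  · refine ⟨_, hmem hζS, fun L h => ?_⟩
    obtain ⟨a, ha, rfl⟩ := hmem' h
    obtain ⟨k, rfl⟩ := hgen a ha
    exact ⟨k, by rw [LaurentOps.polIter_homothety, Units.val_pow_eq_pow_val]⟩
  · obtain ⟨⟨m₀, hm₀, hζm⟩, hζψ⟩ := hζS
    obtain ⟨α, hα, hαψ, hαe⟩ := LaurentOps.exists_pow_eq_of_scale_eq hb hψ₀top hψ₀0 hne
      ((hcdeg f).trans hfd) hd hfψ₀ hpell hg₀ hftψ₀ hm₀ hζm hζψ
    obtain ⟨k, rfl⟩ := hgen α ⟨hα, hαψ⟩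
    rw [hcdeg, ← pow_mul] at hαe
    rw [hcard]
    apply Nat.coprime_of_mul_modEq_one k
    rw [mul_comm]
    exact pow_eq_pow_iff_modEq.1 (hαe.trans (pow_one ζ).symm)
  · intro L h
    obtain ⟨a, ha, rfl⟩ := hmem' h
    rw [LaurentOps.polIter_homothety]
    exact LaurentOps.comp_homothety_eq hb hψ _ hftψ ha
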